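/- For every r ≥ 1, if the rate pair (R₁₂, R₂₁) is admissible for q with r interactive rounds of communication, then (R₁₂, R₂₁) belongs to the closed convex hull of the set of pairs (R'₁₂, R'₂₁) ∈ ℝ² for which there exists a pmf p(u, x¹, x², y¹, y²) whose (x¹,x²,y¹,y²)-marginal equals q, satisfying I_p(X¹; X² | U) ≤ I_q(X¹; X²), the Markov chains Y¹ – (U,X¹) – (X²,Y²) and Y² – (U,X²) – (X¹,Y¹), and |𝒰| ≤ |𝒳¹||𝒴¹||𝒳²||𝒴²| + 1, such that R'₁₂ ≥ I_p(X¹; U | X²), R'₂₁ ≥ I_p(X²; U | X¹), and R'₁₂ + R'₂₁ ≥ I_p(X¹; U | X²) + I_p(X²; U | X¹) + I_q(Y¹; Y² | X¹, X²). -/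

import Mathlib

open scoped BigOperators
open Finset

noncomputable section

namespace Coord

variable {Ω α β γ : Type*}

/-- `p` is a probability mass function on the finite type `α`. -/
def IsPMF [Fintype α] (p : α → ℝ) : Prop := (∀ a, 0 ≤ p a) ∧ ∑ a, p a = 1

/-- ℓ¹ (total variation) distance between two functions on a finite type. -/
def l1dist [Fintype α] (p q : α → ℝ) : ℝ := ∑ a, |p a - q a|

/-- The distribution (pushforward pmf) of the random variable `X` defined on the
finite sample space `Ω` carrying the pmf `μ`. -/
def distr [Fintype Ω] [DecidableEq α] (μ : Ω → ℝ) (X : Ω → α) : α → ℝ :=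
  fun a => ∑ ω, if X ω = a then μ ω else 0

/-- Shannon entropy (base 2) of a pmf. -/
def entFun [Fintype α] (p : α → ℝ) : ℝ := - ∑ a, p a * Real.logb 2 (p a)

/-- Shannon entropy `H(X)` of a random variable `X` on `(Ω, μ)`. -/
def H [Fintype Ω] [Fintype α] [DecidableEq α] (μ : Ω → ℝ) (X : Ω → α) : ℝ :=
  entFun (distr μ X)

/-- Conditional entropy `H(X | Z)`. -/
def condEnt [Fintype Ω] [Fintype α] [Fintype γ] [DecidableEq α] [DecidableEq γ]
    (μ : Ω → ℝ) (X : Ω → α) (Z : Ω → γ) : ℝ :=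
  H μ (fun ω => (X ω, Z ω)) - H μ Z

/-- Mutual information `I(X; Y)`. -/
def mi [Fintype Ω] [Fintype α] [Fintype β] [DecidableEq α] [DecidableEq β]
    (μ : Ω → ℝ) (X : Ω → α) (Y : Ω → β) : ℝ :=
  H μ X + H μ Y - H μ (fun ω => (X ω, Y ω))

/-- Conditional mutual information `I(X; Y | Z)`. -/
def cmi [Fintype Ω] [Fintype α] [Fintype β] [Fintype γ]
    [DecidableEq α] [DecidableEq β] [DecidableEq γ]
    (μ : Ω → ℝ) (X : Ω → α) (Y : Ω → β) (Z : Ω → γ) : ℝ :=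
  H μ (fun ω => (X ω, Z ω)) + H μ (fun ω => (Y ω, Z ω))
    - H μ (fun ω => (X ω, Y ω, Z ω)) - H μ Z

variable {𝒳₁ 𝒳₂ 𝒴₁ 𝒴₂ : Type}

/-- The `(x¹, x²)`-marginal of `q(x¹, x², y¹, y²)`. -/
def srcMarg [Fintype 𝒴₁] [Fintype 𝒴₂] (q : 𝒳₁ × 𝒳₂ × 𝒴₁ × 𝒴₂ → ℝ) :
    𝒳₁ × 𝒳₂ → ℝ := fun x => ∑ y₁, ∑ y₂, q (x.1, x.2, y₁, y₂)

/-- The rate pair `(R12, R21)` is admissible for the coordination problem `q` with `r`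
interactive rounds of communication: for every `ε > 0`, for all large enough block
lengths `n`, there is a finite probability space carrying the i.i.d. sources, private
randomness `M₁, M₂`, interactive messages `C i` (messages with even Lean-index,
i.e. odd 1-based index, are sent by the first node), and outputs `Y₁, Y₂`,
meeting the rate constraints and approximating the i.i.d. target distribution
within total variation `ε`. -/
def Admissible [Fintype 𝒳₁] [Fintype 𝒳₂] [Fintype 𝒴₁] [Fintype 𝒴₂]
    [DecidableEq 𝒳₁] [DecidableEq 𝒳₂] [DecidableEq 𝒴₁] [DecidableEq 𝒴₂]
    (q : 𝒳₁ × 𝒳₂ × 𝒴₁ × 𝒴₂ → ℝ) (r : ℕ) (R12 R21 : ℝ) : Prop :=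
  ∀ ε : ℝ, 0 < ε → ∃ n₀ : ℕ, ∀ n : ℕ, n₀ ≤ n →
    ∃ (Ω 𝓜₁ 𝓜₂ : Type) (𝓒 : Fin r → Type)
      (_ : Fintype Ω) (_ : DecidableEq Ω)
      (_ : Fintype 𝓜₁) (_ : DecidableEq 𝓜₁)
      (_ : Fintype 𝓜₂) (_ : DecidableEq 𝓜₂)
      (_ : ∀ i, Fintype (𝓒 i)) (_ : ∀ i, DecidableEq (𝓒 i))
      (μ : Ω → ℝ)
      (X₁ : Ω → Fin n → 𝒳₁) (X₂ : Ω → Fin n → 𝒳₂)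
      (M₁ : Ω → 𝓜₁) (M₂ : Ω → 𝓜₂)
      (C : (i : Fin r) → Ω → 𝓒 i)
      (Y₁ : Ω → Fin n → 𝒴₁) (Y₂ : Ω → Fin n → 𝒴₂),
      IsPMF μ ∧
      -- the source pairs are i.i.d. with per-letter distribution the (x¹,x²)-marginal of q
      (distr μ (fun ω => (X₁ ω, X₂ ω)) =
        fun x => ∏ k, srcMarg q (x.1 k, x.2 k)) ∧
      -- M₁, M₂ and the sources are mutually independent
      (distr μ (fun ω => (M₁ ω, M₂ ω, X₁ ω, X₂ ω)) =
        fun m => distr μ M₁ m.1 * distr μ M₂ m.2.1 *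
          distr μ (fun ω => (X₁ ω, X₂ ω)) m.2.2) ∧
      -- messages with odd 1-based index are functions of (previous messages, X¹, M₁)
      (∀ i : Fin r, (i : ℕ) % 2 = 0 →
        condEnt μ (C i)
          (fun ω => ((fun j : Fin (i : ℕ) => C ⟨j.1, j.2.trans i.2⟩ ω), X₁ ω, M₁ ω)) = 0) ∧
      -- messages with even 1-based index are functions of (previous messages, X², M₂)
      (∀ i : Fin r, (i : ℕ) % 2 = 1 →
        condEnt μ (C i)
          (fun ω => ((fun j : Fin (i : ℕ) => C ⟨j.1, j.2.trans i.2⟩ ω), X₂ ω, M₂ ω)) = 0) ∧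
      -- rate constraints
      (∑ i ∈ Finset.univ.filter (fun i : Fin r => (i : ℕ) % 2 = 0), H μ (C i)) ≤ n * R12 ∧
      (∑ i ∈ Finset.univ.filter (fun i : Fin r => (i : ℕ) % 2 = 1), H μ (C i)) ≤ n * R21 ∧
      -- the outputs are produced from the locally available information
      condEnt μ Y₁ (fun ω => (X₁ ω, M₁ ω, fun i : Fin r => C i ω)) = 0 ∧
      condEnt μ Y₂ (fun ω => (X₂ ω, M₂ ω, fun i : Fin r => C i ω)) = 0 ∧
      -- total variation distance to the i.i.d. target is at most ε
      l1dist (distr μ (fun ω => (X₁ ω, X₂ ω, Y₁ ω, Y₂ ω)))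
        (fun a => ∏ k, q (a.1 k, a.2.1 k, a.2.2.1 k, a.2.2.2 k)) ≤ ε

set_option linter.unusedSectionVars false

/-- On the support of `μ`, the value of `X` is determined by the value of `Z`. -/
def Det (μ : Ω → ℝ) (Z : Ω → γ) (X : Ω → α) : Prop :=
  ∀ ω ω', μ ω ≠ 0 → μ ω' ≠ 0 → Z ω = Z ω' → X ω = X ω'

section Basic

variable [Fintype Ω] [Fintype α] [Fintype β] [Fintype γ]
  [DecidableEq α] [DecidableEq β] [DecidableEq γ] {μ : Ω → ℝ}

lemma distr_nonneg (hμ : ∀ ω, 0 ≤ μ ω) (X : Ω → α) (a : α) : 0 ≤ distr μ X a :=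
  Finset.sum_nonneg fun ω _ => by split_ifs <;> simp [hμ]

lemma sum_distr_mul (μ : Ω → ℝ) (X : Ω → α) (f : α → ℝ) :
    ∑ a, distr μ X a * f a = ∑ ω, μ ω * f (X ω) := by
  simp only [distr, Finset.sum_mul]
  rw [Finset.sum_comm]
  refine Finset.sum_congr rfl fun ω _ => ?_
  simp [ite_mul]

lemma sum_distr (μ : Ω → ℝ) (X : Ω → α) : ∑ a, distr μ X a = ∑ ω, μ ω := by
  simpa using sum_distr_mul μ X (fun _ => 1)

lemma isPMF_distr (hμ : IsPMF μ) (X : Ω → α) : IsPMF (distr μ X) :=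
  ⟨distr_nonneg hμ.1 X, by rw [sum_distr, hμ.2]⟩

lemma H_eq (μ : Ω → ℝ) (X : Ω → α) :
    H μ X = - ∑ ω, μ ω * Real.logb 2 (distr μ X (X ω)) := by
  simp only [H, entFun]
  rw [sum_distr_mul μ X (fun a => Real.logb 2 (distr μ X a))]

lemma distr_distr (μ : Ω → ℝ) (X : Ω → α) (f : α → β) :
    distr (distr μ X) f = distr μ (fun ω => f (X ω)) := by
  funext b
  have := sum_distr_mul μ X (fun a => if f a = b then 1 else 0)
  simpa [distr] using this

lemma H_distr (μ : Ω → ℝ) (X : Ω → α) (f : α → β) :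
    H (distr μ X) f = H μ (fun ω => f (X ω)) := by
  simp only [H, distr_distr]

lemma le_distr (hμ : ∀ ω, 0 ≤ μ ω) (X : Ω → α) (ω : Ω) : μ ω ≤ distr μ X (X ω) := by
  have := Finset.single_le_sum (f := fun ω' => if X ω' = X ω then μ ω' else 0)
    (fun ω' _ => by split_ifs <;> simp [hμ]) (Finset.mem_univ ω)
  simpa [distr] using this

lemma distr_pos (hμ : ∀ ω, 0 ≤ μ ω) (X : Ω → α) {ω : Ω} (h : μ ω ≠ 0) :
    0 < distr μ X (X ω) :=
  lt_of_lt_of_le (lt_of_le_of_ne (hμ ω) (Ne.symm h)) (le_distr hμ X ω)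

lemma H_congr {X : Ω → α} {Y : Ω → β} (h₁ : Det μ X Y) (h₂ : Det μ Y X) : H μ X = H μ Y := by
  rw [H_eq, H_eq]
  congr 1
  refine Finset.sum_congr rfl fun ω _ => ?_
  by_cases h : μ ω = 0
  · simp [h]
  congr 2
  refine Finset.sum_congr rfl fun ω' _ => ?_
  by_cases h' : μ ω' = 0
  · simp [h']
  exact if_congr ⟨h₁ _ _ h' h, h₂ _ _ h' h⟩ rfl rfl

lemma distr_pair_sum (μ : Ω → ℝ) (X : Ω → α) (Z : Ω → γ) (c : γ) :
    ∑ a, distr μ (fun ω => (X ω, Z ω)) (a, c) = distr μ Z c := by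
  simp only [distr]
  rw [Finset.sum_comm]
  refine Finset.sum_congr rfl fun ω _ => ?_
  simp [Prod.ext_iff, ite_and]

lemma cmi_nonneg (hμ : ∀ ω, 0 ≤ μ ω) (X : Ω → α) (Y : Ω → β) (Z : Ω → γ) :
    0 ≤ cmi μ X Y Z := by
  set A := distr μ (fun ω => (X ω, Z ω)) with hA
  set B := distr μ (fun ω => (Y ω, Z ω)) with hB
  set S := distr μ (fun ω => (X ω, Y ω, Z ω)) with hS
  set I := distr μ Z with hI
  have hA0 := distr_nonneg hμ (fun ω => (X ω, Z ω))
  have hB0 := distr_nonneg hμ (fun ω => (Y ω, Z ω))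
  have hS0 := distr_nonneg hμ (fun ω => (X ω, Y ω, Z ω))
  have hI0 := distr_nonneg hμ Z
  have hlog : ∀ ω, μ ω * (Real.log (A (X ω, Z ω)) + Real.log (B (Y ω, Z ω))
      - Real.log (S (X ω, Y ω, Z ω)) - Real.log (I (Z ω))) ≤
      μ ω * (A (X ω, Z ω) * B (Y ω, Z ω) / (S (X ω, Y ω, Z ω) * I (Z ω)) - 1) := by
    intro ω
    by_cases h : μ ω = 0
    · simp [h]
    have h1 : 0 < A (X ω, Z ω) := distr_pos hμ (fun ω => (X ω, Z ω)) h
    have h2 : 0 < B (Y ω, Z ω) := distr_pos hμ (fun ω => (Y ω, Z ω)) h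
    have h3 : 0 < S (X ω, Y ω, Z ω) := distr_pos hμ (fun ω => (X ω, Y ω, Z ω)) h
    have h4 : 0 < I (Z ω) := distr_pos hμ Z h
    refine mul_le_mul_of_nonneg_left ?_ (hμ ω)
    have := Real.log_le_sub_one_of_pos
      (show 0 < A (X ω, Z ω) * B (Y ω, Z ω) / (S (X ω, Y ω, Z ω) * I (Z ω)) by positivity)
    rw [Real.log_div (by positivity) (by positivity), Real.log_mul h1.ne' h2.ne',
      Real.log_mul h3.ne' h4.ne'] at this
    linarith
  have hratio : ∑ ω, μ ω * (A (X ω, Z ω) * B (Y ω, Z ω) / (S (X ω, Y ω, Z ω) * I (Z ω)))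
      ≤ ∑ ω, μ ω := by
    have e1 := sum_distr_mul μ (fun ω => (X ω, Y ω, Z ω))
      (fun a => A (a.1, a.2.2) * B (a.2.1, a.2.2) / (S a * I a.2.2))
    rw [← e1, ← sum_distr μ Z, ← hS]
    calc ∑ a, S a * (A (a.1, a.2.2) * B (a.2.1, a.2.2) / (S a * I a.2.2))
        ≤ ∑ a : α × β × γ, A (a.1, a.2.2) * B (a.2.1, a.2.2) / I a.2.2 := by
          refine Finset.sum_le_sum fun a _ => ?_
          have hn : 0 ≤ A (a.1, a.2.2) * B (a.2.1, a.2.2) / I a.2.2 :=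
            div_nonneg (mul_nonneg (hA0 _) (hB0 _)) (hI0 _)
          by_cases hs : S a = 0
          · simpa [hs] using hn
          · refine le_of_eq ?_
            rw [mul_div_assoc', mul_div_mul_left _ _ hs]
      _ = ∑ c, (∑ a, A (a, c)) * (∑ b, B (b, c)) / I c := by
          simp only [Fintype.sum_prod_type, Finset.sum_mul_sum, Finset.sum_div]
          rw [Finset.sum_comm' (s := univ) (t := fun _ => univ) (t' := univ)
            (s' := fun _ => univ) (by simp)]
          conv_rhs => rw [Finset.sum_comm]
          rw [Finset.sum_comm]
          refine Finset.sum_congr rfl fun a _ => ?_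
          rw [Finset.sum_comm]
      _ = ∑ c, I c := by
          refine Finset.sum_congr rfl fun c _ => ?_
          rw [hA, hB, distr_pair_sum, distr_pair_sum, ← hI]
          by_cases h : I c = 0
          · simp [h]
          · rw [mul_div_assoc, div_self h, mul_one]
  have hkey : ∑ ω, μ ω * (Real.log (A (X ω, Z ω)) + Real.log (B (Y ω, Z ω))
      - Real.log (S (X ω, Y ω, Z ω)) - Real.log (I (Z ω))) ≤ 0 := by
    refine (Finset.sum_le_sum fun ω (_ : ω ∈ univ) => hlog ω).trans ?_
    simp only [mul_sub, mul_one, Finset.sum_sub_distrib] at hratio ⊢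
    linarith
  have hl2 : 0 < Real.log 2 := Real.log_pos one_lt_two
  have : cmi μ X Y Z = -(∑ ω, μ ω * (Real.log (A (X ω, Z ω)) + Real.log (B (Y ω, Z ω))
      - Real.log (S (X ω, Y ω, Z ω)) - Real.log (I (Z ω)))) / Real.log 2 := by
    simp only [cmi, H_eq, Real.logb, ← hA, ← hB, ← hS, ← hI]
    simp only [mul_div_assoc', ← Finset.sum_div, mul_sub, mul_add, Finset.sum_sub_distrib,
      Finset.sum_add_distrib]
    ring
  rw [this]
  exact div_nonneg (by linarith) hl2.le

/-- Submodularity of entropy: `S` is determined by `(A, B)` and `I` by each of `A`, `B`. -/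
lemma submod {ι σ : Type*} [Fintype ι] [Fintype σ] [DecidableEq ι] [DecidableEq σ]
    (hμ : ∀ ω, 0 ≤ μ ω) {A : Ω → α} {B : Ω → β} {S : Ω → σ} {I : Ω → ι}
    (hS : Det μ (fun ω => (A ω, B ω)) S) (hA : Det μ A I) (hB : Det μ B I) :
    H μ S + H μ I ≤ H μ A + H μ B := by
  have mono : H μ S ≤ H μ (fun ω => (A ω, B ω)) := by
    have h := cmi_nonneg hμ (fun ω => (A ω, B ω)) (fun ω => (A ω, B ω)) S
    have e1 : H μ (fun ω => ((A ω, B ω), S ω)) = H μ (fun ω => (A ω, B ω)) :=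
      H_congr (fun ω ω' _ _ e => (Prod.ext_iff.1 e).1)
        (fun ω ω' h h' e => Prod.ext e (hS ω ω' h h' e))
    have e2 : H μ (fun ω => ((A ω, B ω), (A ω, B ω), S ω)) = H μ (fun ω => (A ω, B ω)) :=
      H_congr (fun ω ω' _ _ e => (Prod.ext_iff.1 e).1)
        (fun ω ω' h h' e => Prod.ext e (Prod.ext e (hS ω ω' h h' e)))
    simp only [cmi, e1, e2] at h
    linarith
  have h := cmi_nonneg hμ A B I
  have e1 : H μ (fun ω => (A ω, I ω)) = H μ A :=
    H_congr (fun ω ω' _ _ e => (Prod.ext_iff.1 e).1)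
      (fun ω ω' h h' e => Prod.ext e (hA ω ω' h h' e))
  have e2 : H μ (fun ω => (B ω, I ω)) = H μ B :=
    H_congr (fun ω ω' _ _ e => (Prod.ext_iff.1 e).1)
      (fun ω ω' h h' e => Prod.ext e (hB ω ω' h h' e))
  have e3 : H μ (fun ω => (A ω, B ω, I ω)) = H μ (fun ω => (A ω, B ω)) :=
    H_congr (fun ω ω' _ _ e => by
        simp only [Prod.mk.injEq] at e ⊢; exact ⟨e.1, e.2.1⟩)
      (fun ω ω' h h' e => by
        simp only [Prod.mk.injEq] at e ⊢; exact ⟨e.1, e.2, hA ω ω' h h' e.1⟩)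
  simp only [cmi, e1, e2, e3] at h
  linarith

lemma H_mono (hμ : ∀ ω, 0 ≤ μ ω) {A : Ω → α} {S : Ω → β} (h : Det μ A S) : H μ S ≤ H μ A := by
  have := submod (S := A) hμ (fun ω ω' _ _ e => (Prod.ext_iff.1 e).1) h h
  linarith

lemma H_const (hμ : IsPMF μ) {X : Ω → α} (h : ∀ ω ω', X ω = X ω') : H μ X = 0 := by
  rw [H_eq]
  have : ∀ ω, distr μ X (X ω) = 1 := fun ω => by
    simp only [distr]
    rw [← hμ.2]
    exact Finset.sum_congr rfl fun ω' _ => if_pos (h _ _)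
  simp [this]

/-- Subadditivity of entropy. -/
lemma H_pair_le (hμ : IsPMF μ) {A : Ω → α} {B : Ω → β} {S : Ω → γ}
    (hS : Det μ (fun ω => (A ω, B ω)) S) : H μ S ≤ H μ A + H μ B := by
  have := submod (I := fun _ => ()) hμ.1 hS (fun _ _ _ _ _ => rfl) (fun _ _ _ _ _ => rfl)
  rw [H_const hμ (X := fun _ => ()) (fun _ _ => rfl)] at this
  linarith

lemma det_of_condEnt_eq_zero (hμ : ∀ ω, 0 ≤ μ ω) {X : Ω → α} {Z : Ω → γ}
    (h : condEnt μ X Z = 0) : Det μ Z X := by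
  have hle : ∀ ω, distr μ (fun ω => (X ω, Z ω)) (X ω, Z ω) ≤ distr μ Z (Z ω) := fun ω => by
    simp only [distr]
    refine Finset.sum_le_sum fun ω' _ => ?_
    by_cases h1 : Z ω' = Z ω <;> by_cases h2 : X ω' = X ω <;> simp [h1, h2, hμ]
  have hterm : ∀ ω ∈ (univ : Finset Ω), 0 ≤ μ ω * (Real.logb 2 (distr μ Z (Z ω)) -
      Real.logb 2 (distr μ (fun ω => (X ω, Z ω)) (X ω, Z ω))) := fun ω _ => by
    by_cases h0 : μ ω = 0
    · simp [h0]
    have hp := distr_pos hμ (fun ω => (X ω, Z ω)) h0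
    exact mul_nonneg (hμ ω) (sub_nonneg.2 (Real.logb_le_logb_of_le one_lt_two hp (hle ω)))
  have hsum : ∑ ω, μ ω * (Real.logb 2 (distr μ Z (Z ω)) -
      Real.logb 2 (distr μ (fun ω => (X ω, Z ω)) (X ω, Z ω))) = 0 := by
    simp only [condEnt, H_eq] at h
    simp only [mul_sub, Finset.sum_sub_distrib]
    linarith
  have hz := (Finset.sum_eq_zero_iff_of_nonneg hterm).1 hsum
  intro ω ω' h0 h0' hZ
  by_contra hX
  have hp := distr_pos hμ (fun ω => (X ω, Z ω)) h0
  have hlt : distr μ (fun ω => (X ω, Z ω)) (X ω, Z ω) < distr μ Z (Z ω) := by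
    simp only [distr]
    refine Finset.sum_lt_sum (fun ω'' _ => ?_) ⟨ω', Finset.mem_univ _, ?_⟩
    · by_cases h1 : Z ω'' = Z ω <;> by_cases h2 : X ω'' = X ω <;> simp [h1, h2, hμ]
    · have : X ω' ≠ X ω := fun e => hX e.symm
      simp only [Prod.mk.injEq, this, false_and, if_false, hZ, if_true]
      exact lt_of_le_of_ne (hμ _) (Ne.symm h0')
  have := Real.logb_lt_logb one_lt_two hp hlt
  rcases mul_eq_zero.1 (hz ω (Finset.mem_univ _)) with h1 | h1
  · exact h0 h1
  · linarith

end Basic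

section Product

variable {ι : Type*} [Fintype ι] [DecidableEq ι] [Fintype Ω] [Fintype α] [Fintype β] [Fintype γ]
  [DecidableEq α] [DecidableEq β] [DecidableEq γ] {μ : Ω → ℝ}

lemma distr_prod (p : ι → α → ℝ) (g : ι → α → β) :
    distr (fun w : ι → α => ∏ k, p k (w k)) (fun w k => g k (w k)) =
      fun v => ∏ k, distr (p k) (g k) (v k) := by
  funext v
  simp only [distr]
  rw [Finset.prod_univ_sum, Fintype.piFinset_univ]
  refine Finset.sum_congr rfl fun w _ => ?_
  by_cases h : ∀ k, g k (w k) = v k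
  · simp [h]
  · rw [if_neg (fun e => h (congrFun e))]
    obtain ⟨k, hk⟩ := not_forall.1 h
    exact (Finset.prod_eq_zero (Finset.mem_univ k) (if_neg hk)).symm

lemma sum_prod_mul {p : ι → α → ℝ} (hp : ∀ k, ∑ a, p k a = 1) (k : ι) (f : α → ℝ) :
    ∑ w : ι → α, (∏ j, p j (w j)) * f (w k) = ∑ a, p k a * f a := by
  have h1 : ∀ w : ι → α, (∏ j, p j (w j)) * f (w k) =
      ∏ j, p j (w j) * (if j = k then f (w j) else 1) := fun w => by
    rw [Finset.prod_mul_distrib, Finset.prod_ite_eq' univ k (fun j => f (w j))]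
    simp
  simp only [h1]
  have h2 := Finset.prod_univ_sum (fun _ : ι => (univ : Finset α))
    (fun j a => p j a * (if j = k then f a else 1))
  rw [Fintype.piFinset_univ] at h2
  rw [← h2]
  have h3 : ∀ j, ∑ a, p j a * (if j = k then f a else 1) =
      if j = k then ∑ a, p j a * f a else 1 := fun j => by
    split_ifs <;> simp [hp]
  simp only [h3]
  rw [Finset.prod_ite_eq' univ k (fun j => ∑ a, p j a * f a)]
  simp

lemma entFun_prod {p : ι → α → ℝ} (hp : ∀ k, ∑ a, p k a = 1) :
    entFun (fun w : ι → α => ∏ k, p k (w k)) = ∑ k, entFun (p k) := by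
  simp only [entFun, Finset.sum_neg_distrib]
  congr 1
  have h1 : ∀ w : ι → α, (∏ k, p k (w k)) * Real.logb 2 (∏ k, p k (w k)) =
      ∑ k, (∏ j, p j (w j)) * Real.logb 2 (p k (w k)) := fun w => by
    by_cases h : ∏ k, p k (w k) = 0
    · simp [h]
    · rw [← Finset.mul_sum, Real.logb_prod]
      exact fun k hk => (Finset.prod_ne_zero_iff.1 h) k hk
  simp only [h1]
  rw [Finset.sum_comm]
  exact Finset.sum_congr rfl fun k _ => sum_prod_mul hp k (fun a => Real.logb 2 (p k a))

/-- Entropy of a letterwise image of an i.i.d. vector. -/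
lemma H_iid {q : α → ℝ} (hq : IsPMF q) {W : Ω → ι → α}
    (hW : distr μ W = fun w => ∏ k, q (w k)) (g : ι → α → β) :
    H μ (fun ω k => g k (W ω k)) = ∑ k, H q (g k) := by
  have h1 : distr μ (fun ω k => g k (W ω k)) = fun v => ∏ k, distr q (g k) (v k) := by
    rw [← distr_prod, ← hW, distr_distr]
  rw [H, h1, entFun_prod (fun k => (isPMF_distr hq (g k)).2)]
  rfl

lemma distr_iid {q : α → ℝ} (hq : IsPMF q) {W : Ω → ι → α}
    (hW : distr μ W = fun w => ∏ k, q (w k)) (k : ι) :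
    distr μ (fun ω => W ω k) = q := by
  rw [← distr_distr μ W (fun w => w k), hW]
  funext a
  have h := sum_prod_mul (p := fun _ : ι => q) (fun _ => hq.2) k (fun b => if b = a then 1 else 0)
  simpa [distr] using h

/-- Entropy of mutually independent variables. -/
lemma H_indep (hμ : ∀ ω, 0 ≤ μ ω) {A : Ω → α} {B : Ω → β} {X : Ω → γ}
    (h : distr μ (fun ω => (A ω, B ω, X ω)) =
      fun m => distr μ A m.1 * distr μ B m.2.1 * distr μ X m.2.2) :
    H μ (fun ω => (A ω, B ω, X ω)) = H μ A + H μ B + H μ X := by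
  simp only [H_eq, h]
  rw [← neg_add, ← neg_add, ← Finset.sum_add_distrib, ← Finset.sum_add_distrib]
  congr 1
  refine Finset.sum_congr rfl fun ω _ => ?_
  by_cases h0 : μ ω = 0
  · simp [h0]
  rw [Real.logb_mul (mul_ne_zero (distr_pos hμ A h0).ne' (distr_pos hμ B h0).ne')
    (distr_pos hμ X h0).ne', Real.logb_mul (distr_pos hμ A h0).ne' (distr_pos hμ B h0).ne']
  ring

lemma abs_sub_le_l1dist (P Q : α → ℝ) (a : α) : |P a - Q a| ≤ l1dist P Q :=
  Finset.single_le_sum (f := fun a => |P a - Q a|) (fun _ _ => abs_nonneg _) (Finset.mem_univ a)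

lemma l1dist_distr_le (P Q : α → ℝ) (f : α → β) :
    l1dist (distr P f) (distr Q f) ≤ l1dist P Q := by
  simp only [l1dist, distr, ← Finset.sum_sub_distrib]
  calc _ ≤ ∑ b, ∑ a, |(if f a = b then P a else 0) - (if f a = b then Q a else 0)| :=
        Finset.sum_le_sum fun b _ => Finset.abs_sum_le_sum_abs _ _
    _ = ∑ a, |P a - Q a| := by
        rw [Finset.sum_comm]
        refine Finset.sum_congr rfl fun a _ => ?_
        rw [Finset.sum_eq_single (f a)] <;> simp +contextual [eq_comm]

lemma negMulLog_le {p q N : ℝ} (hp : 0 ≤ p) (hp1 : p ≤ 1) (hq : 0 ≤ q) (hN : 1 ≤ N) :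
    q.negMulLog ≤ p.negMulLog + |p - q| * (1 + Real.log N) + 1 / N := by
  have hlN : 0 ≤ Real.log N := Real.log_nonneg hN
  have hN0 : 0 < N := by linarith
  have hNi : 0 ≤ 1 / N := by positivity
  simp only [Real.negMulLog]
  rcases le_or_gt p q with h | h
  · obtain ⟨d, rfl⟩ : ∃ d, q = p + d := ⟨q - p, by ring⟩
    have hd : 0 ≤ d := by linarith
    have habs : |p - (p + d)| = d := by
      rw [abs_sub_comm, add_sub_cancel_left, abs_of_nonneg hd]
    rw [habs]
    rcases hd.eq_or_lt with rfl | hd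
    · simp only [add_zero, zero_mul]; linarith
    have h1 : -(d * Real.log d) ≤ d * Real.log N + 1 / N - d := by
      have := Real.log_le_sub_one_of_pos (show 0 < 1 / N / d by positivity)
      rw [Real.log_div (by positivity) hd.ne', one_div, Real.log_inv] at this
      have h2 := mul_le_mul_of_nonneg_left this hd.le
      have h3 : d * (N⁻¹ / d - 1) = 1 / N - d := by field_simp
      rw [h3] at h2
      linarith
    have h2 : d * Real.log d ≤ d * Real.log (p + d) :=
      mul_le_mul_of_nonneg_left (Real.log_le_log hd (by linarith)) hd.le
    have h3 : p * Real.log p ≤ p * Real.log (p + d) := by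
      rcases hp.eq_or_lt with rfl | hp
      · simp
      · exact mul_le_mul_of_nonneg_left (Real.log_le_log hp (by linarith)) hp.le
    nlinarith
  · have habs : |p - q| = p - q := abs_of_pos (by linarith)
    rw [habs]
    have hp0 : 0 < p := by linarith
    have hlp : Real.log p ≤ 0 := Real.log_nonpos hp hp1
    have h1 : 0 ≤ (p - q) * Real.log N := mul_nonneg (by linarith) hlN
    have h2 : p * Real.log p ≤ q * Real.log p := mul_le_mul_of_nonpos_right h.le hlp
    rcases hq.eq_or_lt with rfl | hq
    · simp only [zero_mul, sub_zero] at *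
      nlinarith
    have := Real.log_le_sub_one_of_pos (show 0 < p / q by positivity)
    rw [Real.log_div hp0.ne' hq.ne'] at this
    have h4 := mul_le_mul_of_nonneg_left this hq.le
    have h3 : q * (p / q - 1) = p - q := by field_simp
    nlinarith

/-- A continuity estimate for entropy in total variation. -/
lemma entFun_le_of_l1dist_le {P Q : α → ℝ} (hP : IsPMF P) (hQ : IsPMF Q) {ε : ℝ}
    (h : l1dist P Q ≤ ε) :
    entFun Q ≤ entFun P + (ε * (1 + Real.log (Fintype.card α)) + 1) / Real.log 2 := by
  have hl2 : 0 < Real.log 2 := Real.log_pos one_lt_two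
  have hne : Nonempty α := by
    by_contra hc
    rw [not_nonempty_iff] at hc
    have := hP.2
    simp at this
  have hN : (1 : ℝ) ≤ Fintype.card α := by exact_mod_cast Fintype.card_pos
  have hent : ∀ R : α → ℝ, entFun R = (∑ a, (R a).negMulLog) / Real.log 2 := fun R => by
    simp only [entFun, Real.negMulLog, Real.logb, Finset.sum_div, ← Finset.sum_neg_distrib]
    exact Finset.sum_congr rfl fun a _ => by ring
  have hP1 : ∀ a, P a ≤ 1 := fun a => by
    rw [← hP.2]; exact Finset.single_le_sum (fun b _ => hP.1 b) (Finset.mem_univ a)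
  rw [hent, hent, ← add_div]
  refine div_le_div_of_nonneg_right ?_ hl2.le
  calc ∑ a, (Q a).negMulLog
      ≤ ∑ a, ((P a).negMulLog + |P a - Q a| * (1 + Real.log (Fintype.card α))
          + 1 / (Fintype.card α : ℝ)) :=
        Finset.sum_le_sum fun a _ => negMulLog_le (hP.1 a) (hP1 a) (hQ.1 a) hN
    _ = ∑ a, (P a).negMulLog + l1dist P Q * (1 + Real.log (Fintype.card α)) + 1 := by
        rw [Finset.sum_add_distrib, Finset.sum_add_distrib, ← Finset.sum_mul]
        simp [l1dist]
    _ ≤ _ := by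
        have := mul_le_mul_of_nonneg_right h
          (show 0 ≤ 1 + Real.log (Fintype.card α) by linarith [Real.log_nonneg hN])
        linarith

end Product

section Protocol

variable {δ : Type*} [Fintype Ω] [Fintype α] [Fintype β] [Fintype γ] [Fintype δ]
  [DecidableEq α] [DecidableEq β] [DecidableEq γ] [DecidableEq δ] {μ : Ω → ℝ}

/-- A message computed at one terminal does not increase the conditional mutual information
between the two terminals. -/
lemma H_step (hμ : ∀ ω, 0 ≤ μ ω) {A : Ω → α} {B : Ω → β} {C C' : Ω → γ} (V : Ω → δ)
    (h₁ : Det μ (fun ω => (A ω, C ω)) C') (h₂ : Det μ C' C) :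
    H μ (fun ω => (A ω, C' ω, V ω)) = H μ (fun ω => (A ω, C ω, V ω)) ∧
    H μ (fun ω => (A ω, B ω, C' ω, V ω)) = H μ (fun ω => (A ω, B ω, C ω, V ω)) ∧
    H μ (fun ω => (B ω, C' ω, V ω)) + H μ (fun ω => (C ω, V ω)) ≤
      H μ (fun ω => (B ω, C ω, V ω)) + H μ (fun ω => (C' ω, V ω)) := by
  refine ⟨H_congr ?_ ?_, H_congr ?_ ?_, submod hμ ?_ ?_ ?_⟩ <;>
  · intro ω ω' h h' e
    have := h₁ ω ω' h h'
    have := h₂ ω ω' h h'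
    simp only [Prod.mk.injEq] at *
    grind

/-- Interactive communication does not increase conditional mutual information. -/
lemma H_protocol (hμ : ∀ ω, 0 ≤ μ ω) (A : Ω → α) (B : Ω → β) (C : ℕ → Ω → γ) (V : Ω → δ)
    (hA : ∀ t, t % 2 = 0 → Det μ (fun ω => (A ω, C t ω)) (C (t + 1)))
    (hB : ∀ t, t % 2 = 1 → Det μ (fun ω => (B ω, C t ω)) (C (t + 1)))
    (hC : ∀ t, Det μ (C (t + 1)) (C t)) (hC0 : ∀ ω ω', C 0 ω = C 0 ω') (t : ℕ) :
    H μ (fun ω => (A ω, C t ω, V ω)) + H μ (fun ω => (B ω, C t ω, V ω)) -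
      H μ (fun ω => (A ω, B ω, C t ω, V ω)) - H μ (fun ω => (C t ω, V ω)) ≤
    H μ (fun ω => (A ω, V ω)) + H μ (fun ω => (B ω, V ω)) -
      H μ (fun ω => (A ω, B ω, V ω)) - H μ V := by
  induction t with
  | zero =>
    refine le_of_eq ?_
    congr 1; congr 1; congr 1
    all_goals
      refine H_congr ?_ ?_ <;>
      · intro ω ω' h h' e
        have := hC0 ω ω'
        simp only [Prod.mk.injEq] at *
        grind
  | succ t ih =>
    refine le_trans ?_ ih
    rcases Nat.mod_two_eq_zero_or_one t with h | h
    · obtain ⟨e1, e2, e3⟩ := H_step (B := B) hμ V (hA t h) (hC t)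
      linarith
    · obtain ⟨e1, e2, e3⟩ := H_step (B := A) hμ V (hB t h) (hC t)
      have e4 : ∀ t, H μ (fun ω => (A ω, B ω, C t ω, V ω)) =
          H μ (fun ω => (B ω, A ω, C t ω, V ω)) := fun t => by
        refine H_congr ?_ ?_ <;>
        · intro ω ω' h h' e
          simp only [Prod.mk.injEq] at *
          grind
      rw [e4, e4]
      linarith

end Protocol

/-- An interactive protocol: `C t` is the transcript after `t` messages, sent alternately by the
terminals observing `(X₁, M₁)` and `(X₂, M₂)`; the outputs are computed after `r` messages. -/
structure Interactive {Ω ξ₁ ξ₂ m₁ m₂ γ η₁ η₂ : Type*} [Fintype Ω]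
    [DecidableEq ξ₁] [DecidableEq ξ₂] [DecidableEq m₁] [DecidableEq m₂]
    (μ : Ω → ℝ) (X₁ : Ω → ξ₁) (X₂ : Ω → ξ₂) (M₁ : Ω → m₁) (M₂ : Ω → m₂)
    (C : ℕ → Ω → γ) (r : ℕ) (Y₁ : Ω → η₁) (Y₂ : Ω → η₂) : Prop where
  pmf : IsPMF μ
  indep : distr μ (fun ω => (M₁ ω, M₂ ω, X₁ ω, X₂ ω)) =
    fun m => distr μ M₁ m.1 * distr μ M₂ m.2.1 * distr μ (fun ω => (X₁ ω, X₂ ω)) m.2.2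
  start : ∀ ω ω', C 0 ω = C 0 ω'
  prev : ∀ t, Det μ (C (t + 1)) (C t)
  even : ∀ t, t % 2 = 0 → Det μ (fun ω => ((X₁ ω, M₁ ω), C t ω)) (C (t + 1))
  odd : ∀ t, t % 2 = 1 → Det μ (fun ω => ((X₂ ω, M₂ ω), C t ω)) (C (t + 1))
  out₁ : Det μ (fun ω => ((X₁ ω, M₁ ω), C r ω)) Y₁
  out₂ : Det μ (fun ω => ((X₂ ω, M₂ ω), C r ω)) Y₂

section Interactive

variable {ξ₁ ξ₂ m₁ m₂ η₁ η₂ δ : Type*} [Fintype Ω] [Fintype γ] [DecidableEq γ]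
  [Fintype ξ₁] [DecidableEq ξ₁] [Fintype ξ₂] [DecidableEq ξ₂]
  [Fintype m₁] [DecidableEq m₁] [Fintype m₂] [DecidableEq m₂]
  [Fintype η₁] [DecidableEq η₁] [Fintype η₂] [DecidableEq η₂] [Fintype δ] [DecidableEq δ]
  [Fintype α] [DecidableEq α] [Fintype β] [DecidableEq β]
  {μ : Ω → ℝ} {X₁ : Ω → ξ₁} {X₂ : Ω → ξ₂} {M₁ : Ω → m₁} {M₂ : Ω → m₂}
  {C : ℕ → Ω → γ} {r : ℕ} {Y₁ : Ω → η₁} {Y₂ : Ω → η₂}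

lemma Interactive.le_of_source (P : Interactive μ X₁ X₂ M₁ M₂ C r Y₁ Y₂) {V : Ω → δ}
    (hV : Det μ (fun ω => (X₁ ω, X₂ ω)) V) :
    H μ (fun ω => ((X₁ ω, M₁ ω), C r ω, V ω)) + H μ (fun ω => ((X₂ ω, M₂ ω), C r ω, V ω)) -
      H μ (fun ω => ((X₁ ω, M₁ ω), (X₂ ω, M₂ ω), C r ω, V ω)) - H μ (fun ω => (C r ω, V ω)) ≤
    H μ (fun ω => (X₁ ω, V ω)) + H μ (fun ω => (X₂ ω, V ω)) -
      H μ (fun ω => (X₁ ω, X₂ ω)) - H μ V := by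
  have h := H_protocol P.pmf.1 (fun ω => (X₁ ω, M₁ ω)) (fun ω => (X₂ ω, M₂ ω)) C V
    P.even P.odd P.prev P.start r
  have hi := H_indep P.pmf.1 (X := fun ω => (X₁ ω, X₂ ω)) P.indep
  have e1 : H μ (fun ω => ((X₁ ω, M₁ ω), V ω)) ≤ H μ M₁ + H μ (fun ω => (X₁ ω, V ω)) := by
    refine H_pair_le P.pmf ?_
    intro ω ω' h h' e; simp only [Prod.mk.injEq] at *; grind
  have e2 : H μ (fun ω => ((X₂ ω, M₂ ω), V ω)) ≤ H μ M₂ + H μ (fun ω => (X₂ ω, V ω)) := by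
    refine H_pair_le P.pmf ?_
    intro ω ω' h h' e; simp only [Prod.mk.injEq] at *; grind
  have e3 : H μ (fun ω => ((X₁ ω, M₁ ω), (X₂ ω, M₂ ω), V ω)) =
      H μ (fun ω => (M₁ ω, M₂ ω, X₁ ω, X₂ ω)) := by
    refine H_congr ?_ ?_ <;>
    · intro ω ω' h h' e
      have := hV ω ω' h h'
      simp only [Prod.mk.injEq] at *; grind
  linarith

/-- If `V` separates the sources, outputs of the two terminals are conditionally independent
given the transcript and `V`. -/
lemma Interactive.cmi_eq_zero (P : Interactive μ X₁ X₂ M₁ M₂ C r Y₁ Y₂) {V : Ω → δ}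
    (hV : Det μ (fun ω => (X₁ ω, X₂ ω)) V)
    (hV0 : H μ (fun ω => (X₁ ω, V ω)) + H μ (fun ω => (X₂ ω, V ω)) -
      H μ (fun ω => (X₁ ω, X₂ ω)) - H μ V ≤ 0)
    {A : Ω → α} {B : Ω → β}
    (hA : Det μ (fun ω => ((X₁ ω, M₁ ω), C r ω, V ω)) A)
    (hB : Det μ (fun ω => ((X₂ ω, M₂ ω), C r ω, V ω)) B) :
    cmi μ A B (fun ω => (C r ω, V ω)) = 0 := by
  refine le_antisymm ?_ (cmi_nonneg P.pmf.1 _ _ _)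
  have h := (P.le_of_source hV).trans hV0
  have h1 : H μ (fun ω => ((X₁ ω, M₁ ω), B ω, C r ω, V ω)) + H μ (fun ω => (A ω, C r ω, V ω)) ≤
      H μ (fun ω => ((X₁ ω, M₁ ω), C r ω, V ω)) + H μ (fun ω => (A ω, B ω, C r ω, V ω)) := by
    refine submod P.pmf.1 ?_ ?_ ?_ <;>
    · intro ω ω' h h' e
      have := hA ω ω' h h'
      simp only [Prod.mk.injEq] at *; grind
  have h2 : H μ (fun ω => ((X₁ ω, M₁ ω), (X₂ ω, M₂ ω), C r ω, V ω)) +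
      H μ (fun ω => (B ω, C r ω, V ω)) ≤
      H μ (fun ω => ((X₂ ω, M₂ ω), C r ω, V ω)) +
      H μ (fun ω => ((X₁ ω, M₁ ω), B ω, C r ω, V ω)) := by
    refine submod P.pmf.1 ?_ ?_ ?_ <;>
    · intro ω ω' h h' e
      have := hB ω ω' h h'
      simp only [Prod.mk.injEq] at *; grind
  simp only [cmi]
  linarith

lemma Interactive.source_cmi_le (P : Interactive μ X₁ X₂ M₁ M₂ C r Y₁ Y₂) :
    H μ (fun ω => (C r ω, X₁ ω)) + H μ (fun ω => (C r ω, X₂ ω)) -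
      H μ (fun ω => (C r ω, X₁ ω, X₂ ω)) - H μ (C r) ≤
    H μ X₁ + H μ X₂ - H μ (fun ω => (X₁ ω, X₂ ω)) := by
  have h := P.le_of_source (V := fun _ => ()) (fun _ _ _ _ _ => rfl)
  rw [H_const P.pmf (X := fun _ => ()) (fun _ _ => rfl)] at h
  have e1 : H μ (fun ω => (X₁ ω, ())) = H μ X₁ := by
    refine H_congr ?_ ?_ <;> · intro ω ω' h h' e; simp only [Prod.mk.injEq] at *; grind
  have e2 : H μ (fun ω => (X₂ ω, ())) = H μ X₂ := by
    refine H_congr ?_ ?_ <;> · intro ω ω' h h' e; simp only [Prod.mk.injEq] at *; grind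
  have e3 : H μ (fun ω => (C r ω, ())) = H μ (C r) := by
    refine H_congr ?_ ?_ <;> · intro ω ω' h h' e; simp only [Prod.mk.injEq] at *; grind
  have h1 : H μ (fun ω => ((X₁ ω, M₁ ω), X₂ ω, C r ω)) + H μ (fun ω => (C r ω, X₁ ω)) ≤
      H μ (fun ω => ((X₁ ω, M₁ ω), C r ω, ())) + H μ (fun ω => (C r ω, X₁ ω, X₂ ω)) := by
    refine submod P.pmf.1 ?_ ?_ ?_ <;>
    · intro ω ω' h h' e; simp only [Prod.mk.injEq] at *; grind
  have h2 : H μ (fun ω => ((X₁ ω, M₁ ω), (X₂ ω, M₂ ω), C r ω, ())) +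
      H μ (fun ω => (C r ω, X₂ ω)) ≤
      H μ (fun ω => ((X₂ ω, M₂ ω), C r ω, ())) +
      H μ (fun ω => ((X₁ ω, M₁ ω), X₂ ω, C r ω)) := by
    refine submod P.pmf.1 ?_ ?_ ?_ <;>
    · intro ω ω' h h' e; simp only [Prod.mk.injEq] at *; grind
  linarith

/-- Information about `X₁` in the transcript beyond `X₂` is at most the rate of the transcript
given the second terminal. -/
lemma Interactive.info_le₁ (P : Interactive μ X₁ X₂ M₁ M₂ C r Y₁ Y₂) :
    H μ (fun ω => (X₁ ω, X₂ ω)) - H μ X₂ + H μ (fun ω => (C r ω, X₂ ω)) -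
      H μ (fun ω => (C r ω, X₁ ω, X₂ ω)) ≤
    H μ (fun ω => (C r ω, X₂ ω, M₂ ω)) - H μ (fun ω => (X₂ ω, M₂ ω)) := by
  have hi := H_indep P.pmf.1 (X := fun ω => (X₁ ω, X₂ ω)) P.indep
  have h0 : H μ (fun ω => (M₁ ω, M₂ ω, X₁ ω, X₂ ω)) ≤
      H μ M₁ + H μ (fun ω => (X₁ ω, X₂ ω, M₂ ω)) := by
    refine H_pair_le P.pmf ?_
    intro ω ω' h h' e; simp only [Prod.mk.injEq] at *; grind
  have h1 : H μ (fun ω => (X₂ ω, M₂ ω)) ≤ H μ X₂ + H μ M₂ :=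
    H_pair_le P.pmf (fun _ _ _ _ e => e)
  have h2 : H μ (fun ω => (X₁ ω, X₂ ω, M₂ ω)) ≤ H μ (fun ω => (C r ω, X₁ ω, X₂ ω, M₂ ω)) :=
    H_mono P.pmf.1 (fun ω ω' _ _ e => (Prod.ext_iff.1 e).2)
  have h3 : H μ (fun ω => (C r ω, X₁ ω, X₂ ω, M₂ ω)) + H μ (fun ω => (C r ω, X₂ ω)) ≤
      H μ (fun ω => (C r ω, X₂ ω, M₂ ω)) + H μ (fun ω => (C r ω, X₁ ω, X₂ ω)) := by
    refine submod P.pmf.1 ?_ ?_ ?_ <;>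
    · intro ω ω' h h' e; simp only [Prod.mk.injEq] at *; grind
  linarith

lemma Interactive.info_le₂ (P : Interactive μ X₁ X₂ M₁ M₂ C r Y₁ Y₂) :
    H μ (fun ω => (X₁ ω, X₂ ω)) - H μ X₁ + H μ (fun ω => (C r ω, X₁ ω)) -
      H μ (fun ω => (C r ω, X₁ ω, X₂ ω)) ≤
    H μ (fun ω => (C r ω, X₁ ω, M₁ ω)) - H μ (fun ω => (X₁ ω, M₁ ω)) := by
  have hi := H_indep P.pmf.1 (X := fun ω => (X₁ ω, X₂ ω)) P.indep
  have h0 : H μ (fun ω => (M₁ ω, M₂ ω, X₁ ω, X₂ ω)) ≤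
      H μ M₂ + H μ (fun ω => (X₁ ω, X₂ ω, M₁ ω)) := by
    refine H_pair_le P.pmf ?_
    intro ω ω' h h' e; simp only [Prod.mk.injEq] at *; grind
  have h1 : H μ (fun ω => (X₁ ω, M₁ ω)) ≤ H μ X₁ + H μ M₁ :=
    H_pair_le P.pmf (fun _ _ _ _ e => e)
  have h2 : H μ (fun ω => (X₁ ω, X₂ ω, M₁ ω)) ≤ H μ (fun ω => (C r ω, X₁ ω, X₂ ω, M₁ ω)) :=
    H_mono P.pmf.1 (fun ω ω' _ _ e => (Prod.ext_iff.1 e).2)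
  have h3 : H μ (fun ω => (C r ω, X₁ ω, X₂ ω, M₁ ω)) + H μ (fun ω => (C r ω, X₁ ω)) ≤
      H μ (fun ω => (C r ω, X₁ ω, M₁ ω)) + H μ (fun ω => (C r ω, X₁ ω, X₂ ω)) := by
    refine submod P.pmf.1 ?_ ?_ ?_ <;>
    · intro ω ω' h h' e; simp only [Prod.mk.injEq] at *; grind
  linarith

/-- The transcript carries both the exchanged source information and the correlation of the
outputs given the sources. -/
lemma Interactive.sum_info_le (P : Interactive μ X₁ X₂ M₁ M₂ C r Y₁ Y₂) :
    (H μ (fun ω => (X₁ ω, X₂ ω)) - H μ X₂ + H μ (fun ω => (C r ω, X₂ ω)) -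
      H μ (fun ω => (C r ω, X₁ ω, X₂ ω))) +
    (H μ (fun ω => (X₁ ω, X₂ ω)) - H μ X₁ + H μ (fun ω => (C r ω, X₁ ω)) -
      H μ (fun ω => (C r ω, X₁ ω, X₂ ω))) +
    cmi μ Y₁ Y₂ (fun ω => (X₁ ω, X₂ ω)) ≤ H μ (C r) := by
  have hs := P.source_cmi_le
  have h0 := P.cmi_eq_zero (V := fun ω => (X₁ ω, X₂ ω)) (A := Y₁) (B := Y₂)
    (fun _ _ _ _ e => e) (by
      have e1 : H μ (fun ω => (X₁ ω, X₁ ω, X₂ ω)) = H μ (fun ω => (X₁ ω, X₂ ω)) := by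
        refine H_congr ?_ ?_ <;> · intro ω ω' h h' e; simp only [Prod.mk.injEq] at *; grind
      have e2 : H μ (fun ω => (X₂ ω, X₁ ω, X₂ ω)) = H μ (fun ω => (X₁ ω, X₂ ω)) := by
        refine H_congr ?_ ?_ <;> · intro ω ω' h h' e; simp only [Prod.mk.injEq] at *; grind
      rw [e1, e2]; linarith)
    (fun ω ω' h h' e => P.out₁ ω ω' h h' (by simp only [Prod.mk.injEq] at *; grind))
    (fun ω ω' h h' e => P.out₂ ω ω' h h' (by simp only [Prod.mk.injEq] at *; grind))
  have h1 : H μ (fun ω => (Y₂ ω, X₁ ω, X₂ ω)) + H μ (fun ω => (Y₁ ω, Y₂ ω, C r ω, X₁ ω, X₂ ω)) ≤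
      H μ (fun ω => (Y₂ ω, C r ω, X₁ ω, X₂ ω)) + H μ (fun ω => (Y₁ ω, Y₂ ω, X₁ ω, X₂ ω)) := by
    rw [add_comm (H μ (fun ω => (Y₂ ω, X₁ ω, X₂ ω)))]
    refine submod P.pmf.1 ?_ ?_ ?_ <;>
    · intro ω ω' h h' e; simp only [Prod.mk.injEq] at *; grind
  have h2 : H μ (fun ω => (Y₁ ω, X₁ ω, X₂ ω)) ≤ H μ (fun ω => (Y₁ ω, C r ω, X₁ ω, X₂ ω)) := by
    refine H_mono P.pmf.1 ?_
    intro ω ω' h h' e; simp only [Prod.mk.injEq] at *; grind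
  simp only [cmi] at h0 ⊢
  linarith

lemma H_chain {C : ℕ → Ω → γ} {Z : Ω → δ} (h0 : ∀ ω ω', C 0 ω = C 0 ω') (a : ℕ → ℝ)
    (h : ∀ t, H μ (fun ω => (C (t + 1) ω, Z ω)) ≤ H μ (fun ω => (C t ω, Z ω)) + a t) (r : ℕ) :
    H μ (fun ω => (C r ω, Z ω)) ≤ H μ Z + ∑ t ∈ Finset.range r, a t := by
  induction r with
  | zero =>
    simp only [Finset.range_zero, Finset.sum_empty, add_zero]
    refine le_of_eq (H_congr ?_ ?_) <;>
    · intro ω ω' h h' e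
      have := h0 ω ω'
      simp only [Prod.mk.injEq] at *; grind
  | succ r ih => rw [Finset.sum_range_succ]; linarith [h r]

end Interactive

section Masks

variable {n : ℕ}

/-- The entries of `x` with index below `t`. -/
def below (t : ℕ) (x : Fin n → α) : Fin n → Option α :=
  fun j => if (j : ℕ) < t then some (x j) else none

/-- The entries of `x` with index at least `t`. -/
def above (t : ℕ) (x : Fin n → α) : Fin n → Option α :=
  fun j => if t ≤ (j : ℕ) then some (x j) else none

lemma below_eq_iff {t : ℕ} {x y : Fin n → α} :
    below t x = below t y ↔ ∀ j : Fin n, (j : ℕ) < t → x j = y j := by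
  simp only [funext_iff, below]
  refine forall_congr' fun j => ?_
  by_cases h : (j : ℕ) < t <;> simp [h]

lemma above_eq_iff {t : ℕ} {x y : Fin n → α} :
    above t x = above t y ↔ ∀ j : Fin n, t ≤ (j : ℕ) → x j = y j := by
  simp only [funext_iff, above]
  refine forall_congr' fun j => ?_
  by_cases h : t ≤ (j : ℕ) <;> simp [h]

lemma below_succ_iff {x y : Fin n → α} (k : Fin n) :
    below (k + 1) x = below (k + 1) y ↔ x k = y k ∧ below k x = below k y := by
  simp only [below_eq_iff]
  refine ⟨fun h => ⟨h k (Nat.lt_succ_self _), fun j hj => h j (by omega)⟩, fun h j hj => ?_⟩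
  rcases Nat.lt_succ_iff_lt_or_eq.1 hj with hj | hj
  · exact h.2 j hj
  · rw [Fin.ext hj]; exact h.1

lemma above_iff_succ {x y : Fin n → α} (k : Fin n) :
    above k x = above k y ↔ x k = y k ∧ above (k + 1) x = above (k + 1) y := by
  simp only [above_eq_iff]
  refine ⟨fun h => ⟨h k le_rfl, fun j hj => h j (by omega)⟩, fun h j hj => ?_⟩
  rcases hj.eq_or_lt with hj | hj
  · rw [← Fin.ext hj]; exact h.1
  · exact h.2 j hj

lemma above_mono {s t : ℕ} (hst : s ≤ t) {x y : Fin n → α} (h : above s x = above s y) :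
    above t x = above t y :=
  above_eq_iff.2 fun j hj => above_eq_iff.1 h j (by omega)

lemma below_full {x y : Fin n → α} : below n x = below n y ↔ x = y := by
  rw [below_eq_iff, funext_iff]
  simp

lemma above_zero {x y : Fin n → α} : above 0 x = above 0 y ↔ x = y := by
  rw [above_eq_iff, funext_iff]
  simp

lemma below_zero (x y : Fin n → α) : below 0 x = below 0 y := by
  simp [below_eq_iff]

lemma above_full (x y : Fin n → α) : above n x = above n y :=
  above_eq_iff.2 fun j hj => absurd j.2 (by omega)

variable [Fintype Ω] [Fintype α] [Fintype β] [Fintype γ]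
  [DecidableEq α] [DecidableEq β] [DecidableEq γ] {μ : Ω → ℝ}
  {X₁ : Ω → Fin n → α} {X₂ : Ω → Fin n → β}

/-- The two halves of an i.i.d. source separate the remaining entries. -/
lemma masks_separate {s : α × β → ℝ} (hs : IsPMF s)
    (hX : distr μ (fun ω k => (X₁ ω k, X₂ ω k)) = fun w => ∏ k, s (w k)) (t : ℕ) :
    H μ (fun ω => (X₁ ω, below t (X₁ ω), above t (X₂ ω))) +
      H μ (fun ω => (X₂ ω, below t (X₁ ω), above t (X₂ ω))) -
      H μ (fun ω => (X₁ ω, X₂ ω)) - H μ (fun ω => (below t (X₁ ω), above t (X₂ ω))) ≤ 0 := by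
  have e1 : H μ (fun ω => (X₁ ω, below t (X₁ ω), above t (X₂ ω))) =
      ∑ k : Fin n, H s (fun a => (a.1, if t ≤ (k : ℕ) then some a.2 else none)) := by
    rw [← H_iid hs hX (fun (k : Fin n) a => (a.1, if t ≤ (k : ℕ) then some a.2 else none))]
    refine H_congr ?_ ?_ <;>
    · intro ω ω' h h' e
      simp only [Prod.mk.injEq, funext_iff, above, below] at *; grind
  have e2 : H μ (fun ω => (X₂ ω, below t (X₁ ω), above t (X₂ ω))) =
      ∑ k : Fin n, H s (fun a => (if (k : ℕ) < t then some a.1 else none, a.2)) := by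
    rw [← H_iid hs hX (fun (k : Fin n) a => (if (k : ℕ) < t then some a.1 else none, a.2))]
    refine H_congr ?_ ?_ <;>
    · intro ω ω' h h' e
      simp only [Prod.mk.injEq, funext_iff, above, below] at *; grind
  have e3 : H μ (fun ω => (X₁ ω, X₂ ω)) = ∑ k : Fin n, H s (fun a => a) := by
    rw [← H_iid hs hX (fun _ a => a)]
    refine H_congr ?_ ?_ <;>
    · intro ω ω' h h' e
      simp only [Prod.mk.injEq, funext_iff] at *; grind
  have e4 : H μ (fun ω => (below t (X₁ ω), above t (X₂ ω))) =
      ∑ k : Fin n, H s (fun a => (if (k : ℕ) < t then some a.1 else none,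
        if t ≤ (k : ℕ) then some a.2 else none)) := by
    rw [← H_iid hs hX (fun (k : Fin n) a => (if (k : ℕ) < t then some a.1 else none,
        if t ≤ (k : ℕ) then some a.2 else none))]
    refine H_congr ?_ ?_ <;>
    · intro ω ω' h h' e
      simp only [Prod.mk.injEq, funext_iff, above, below] at *; grind
  rw [e1, e2, e3, e4, ← Finset.sum_add_distrib, ← Finset.sum_sub_distrib,
    ← Finset.sum_sub_distrib]
  refine Finset.sum_nonpos fun k _ => ?_
  rw [sub_sub, sub_nonpos, add_comm (H s fun a => a)]
  rcases lt_or_ge (k : ℕ) t with hk | hk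
  · refine le_of_eq (congrArg₂ _ (H_congr ?_ ?_) (H_congr ?_ ?_)) <;>
    · intro ω ω' h h' e
      have : ¬ t ≤ (k : ℕ) := by omega
      simp only [hk, this, if_true, if_false, Prod.mk.injEq, Option.some.injEq] at *; grind
  · rw [add_comm]
    refine le_of_eq (congrArg₂ _ (H_congr ?_ ?_) (H_congr ?_ ?_)) <;>
    · intro ω ω' h h' e
      have : ¬ (k : ℕ) < t := by omega
      simp only [hk, this, if_true, if_false, Prod.mk.injEq, Option.some.injEq] at *; grind

/-- Single-letterization of `H(X₂ | X₁, C)`. -/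
lemma sum_letters_ge (hμ : ∀ ω, 0 ≤ μ ω) (C : Ω → γ) :
    H μ (fun ω => (C ω, X₁ ω, X₂ ω)) - H μ (fun ω => (C ω, X₁ ω)) ≤
      ∑ k : Fin n, (H μ (fun ω => (C ω, below (k + 1) (X₁ ω), above k (X₂ ω))) -
        H μ (fun ω => (C ω, below (k + 1) (X₁ ω), above (k + 1) (X₂ ω)))) := by
  set F : ℕ → ℝ := fun t => H μ (fun ω => (C ω, X₁ ω, above t (X₂ ω))) with hF
  have h0 : H μ (fun ω => (C ω, X₁ ω, X₂ ω)) = F 0 := by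
    refine H_congr ?_ ?_ <;>
    · intro ω ω' h h' e
      simp only [Prod.mk.injEq, above_zero] at *; grind
  have hn : H μ (fun ω => (C ω, X₁ ω)) = F n := by
    refine H_congr ?_ ?_ <;>
    · intro ω ω' h h' e
      have := above_full (X₂ ω) (X₂ ω')
      simp only [Prod.mk.injEq] at *; grind
  have hstep : ∀ k : ℕ, F k - F (k + 1) ≤
      H μ (fun ω => (C ω, below (k + 1) (X₁ ω), above k (X₂ ω))) -
        H μ (fun ω => (C ω, below (k + 1) (X₁ ω), above (k + 1) (X₂ ω))) := fun k => by
    have : F k + H μ (fun ω => (C ω, below (k + 1) (X₁ ω), above (k + 1) (X₂ ω))) ≤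
        H μ (fun ω => (C ω, below (k + 1) (X₁ ω), above k (X₂ ω))) + F (k + 1) := by
      refine submod hμ ?_ ?_ ?_ <;>
      · intro ω ω' h h' e
        have := above_mono (Nat.le_succ k) (x := X₂ ω) (y := X₂ ω')
        simp only [Prod.mk.injEq] at *; grind
    linarith
  rw [h0, hn, Fin.sum_univ_eq_sum_range (fun k =>
    H μ (fun ω => (C ω, below (k + 1) (X₁ ω), above k (X₂ ω))) -
        H μ (fun ω => (C ω, below (k + 1) (X₁ ω), above (k + 1) (X₂ ω)))) n,
    ← Finset.sum_range_sub']
  exact Finset.sum_le_sum fun k _ => hstep k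

/-- Single-letterization of `H(X₂ | C)`. -/
lemma sum_letters_le (hμ : ∀ ω, 0 ≤ μ ω) (C : Ω → γ) :
    ∑ k : Fin n, (H μ (fun ω => (C ω, below k (X₁ ω), above k (X₂ ω))) -
        H μ (fun ω => (C ω, below k (X₁ ω), above (k + 1) (X₂ ω)))) ≤
      H μ (fun ω => (C ω, X₂ ω)) - H μ C := by
  set G : ℕ → ℝ := fun t => H μ (fun ω => (C ω, above t (X₂ ω))) with hG
  have h0 : H μ (fun ω => (C ω, X₂ ω)) = G 0 := by
    refine H_congr ?_ ?_ <;>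
    · intro ω ω' h h' e
      simp only [Prod.mk.injEq, above_zero] at *; grind
  have hn : H μ C = G n := by
    refine H_congr ?_ ?_ <;>
    · intro ω ω' h h' e
      have := above_full (X₂ ω) (X₂ ω')
      simp only [Prod.mk.injEq] at *; grind
  have hstep : ∀ k : ℕ, H μ (fun ω => (C ω, below k (X₁ ω), above k (X₂ ω))) -
        H μ (fun ω => (C ω, below k (X₁ ω), above (k + 1) (X₂ ω))) ≤ G k - G (k + 1) :=
      fun k => by
    have : H μ (fun ω => (C ω, below k (X₁ ω), above k (X₂ ω))) + G (k + 1) ≤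
        G k + H μ (fun ω => (C ω, below k (X₁ ω), above (k + 1) (X₂ ω))) := by
      refine submod hμ ?_ ?_ ?_ <;>
      · intro ω ω' h h' e
        have := above_mono (Nat.le_succ k) (x := X₂ ω) (y := X₂ ω')
        simp only [Prod.mk.injEq] at *; grind
    linarith
  rw [h0, hn, Fin.sum_univ_eq_sum_range (fun k =>
    H μ (fun ω => (C ω, below k (X₁ ω), above k (X₂ ω))) -
        H μ (fun ω => (C ω, below k (X₁ ω), above (k + 1) (X₂ ω)))) n,
    ← Finset.sum_range_sub']
  exact Finset.sum_le_sum fun k _ => hstep k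

end Masks

section TimeSharing

variable {n : ℕ} [Fintype Ω] [Fintype α] [Fintype β] [Fintype γ]
  [DecidableEq α] [DecidableEq β] [DecidableEq γ] {μ : Ω → ℝ}

/-- The product of the uniform pmf on `Fin n` with `μ`. -/
def timeShare (n : ℕ) (μ : Ω → ℝ) : Fin n × Ω → ℝ := fun a => μ a.2 / n

lemma isPMF_timeShare (hn : 0 < n) (hμ : IsPMF μ) : IsPMF (timeShare n μ) := by
  refine ⟨fun a => div_nonneg (hμ.1 _) (Nat.cast_nonneg _), ?_⟩
  have : (n : ℝ) ≠ 0 := by positivity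
  simp only [timeShare, Fintype.sum_prod_type, ← Finset.sum_div, hμ.2]
  simp [this]

lemma distr_timeShare (Z : Fin n × Ω → α) (a : α) :
    distr (timeShare n μ) Z a = (∑ k, distr μ (fun ω => Z (k, ω)) a) / n := by
  simp only [distr, timeShare, Fintype.sum_prod_type, Finset.sum_div]
  refine Finset.sum_congr rfl fun k _ => Finset.sum_congr rfl fun ω _ => ?_
  split_ifs <;> simp

lemma distr_timeShare_const (hn : 0 < n) {Z : Fin n × Ω → α} {ρ : α → ℝ}
    (h : ∀ k, distr μ (fun ω => Z (k, ω)) = ρ) : distr (timeShare n μ) Z = ρ := by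
  have : (n : ℝ) ≠ 0 := by positivity
  funext a
  rw [distr_timeShare]
  simp only [h]
  simp [this]

lemma H_timeShare (hn : 0 < n) (hμ : IsPMF μ) {Z : Fin n × Ω → α} (Z' : Fin n → Ω → β)
    (h : ∀ a b, Z a = Z b ↔ a.1 = b.1 ∧ Z' a.1 a.2 = Z' b.1 b.2) :
    H (timeShare n μ) Z = Real.logb 2 n + (∑ k, H μ (Z' k)) / n := by
  have hn' : (n : ℝ) ≠ 0 := by positivity
  have hd : ∀ k ω, distr (timeShare n μ) Z (Z (k, ω)) = distr μ (Z' k) (Z' k ω) / n := by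
    intro k ω
    simp only [distr, timeShare, Fintype.sum_prod_type, h, Finset.sum_div]
    rw [Finset.sum_eq_single k]
    · refine Finset.sum_congr rfl fun ω' _ => ?_
      simp only [true_and]
      split_ifs <;> simp
    · intro j _ hj
      simp [hj]
    · simp
  simp only [H_eq, Fintype.sum_prod_type, hd]
  have hterm : ∀ k, ∑ ω, timeShare n μ (k, ω) * Real.logb 2 (distr μ (Z' k) (Z' k ω) / n) =
      (∑ ω, μ ω * Real.logb 2 (distr μ (Z' k) (Z' k ω))) / n - Real.logb 2 n / n := fun k => by
    have h1 : ∀ ω, timeShare n μ (k, ω) * Real.logb 2 (distr μ (Z' k) (Z' k ω) / n) =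
        (μ ω * Real.logb 2 (distr μ (Z' k) (Z' k ω))) / n - μ ω * (Real.logb 2 n / n) :=
      fun ω => by
        by_cases h0 : μ ω = 0
        · simp [h0, timeShare]
        rw [Real.logb_div (distr_pos hμ.1 (Z' k) h0).ne' hn', timeShare]
        ring
    simp only [h1, Finset.sum_sub_distrib, ← Finset.sum_div, ← Finset.sum_mul, hμ.2, one_mul]
  simp only [hterm, Finset.sum_sub_distrib, Finset.sum_neg_distrib, ← Finset.sum_div]
  simp only [Finset.sum_const, Finset.card_univ, Fintype.card_fin, nsmul_eq_mul]
  field_simp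
  ring

lemma cmi_comm {μ : Ω → ℝ} (X : Ω → α) (Y : Ω → β) (Z : Ω → γ) : cmi μ X Y Z = cmi μ Y X Z := by
  have : H μ (fun ω => (X ω, Y ω, Z ω)) = H μ (fun ω => (Y ω, X ω, Z ω)) := by
    refine H_congr ?_ ?_ <;>
    · intro ω ω' h h' e
      simp only [Prod.mk.injEq] at *; grind
  simp only [cmi, this]
  ring

lemma cmi_timeShare_eq_zero {δ : Type*} [Fintype δ] [DecidableEq δ] (hn : 0 < n) (hμ : IsPMF μ)
    {A : Fin n × Ω → α} {B : Fin n × Ω → β} {Z : Fin n × Ω → γ} (Z' : Fin n → Ω → δ)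
    (hZ : ∀ a b, Z a = Z b ↔ a.1 = b.1 ∧ Z' a.1 a.2 = Z' b.1 b.2)
    (h : ∀ k, cmi μ (fun ω => A (k, ω)) (fun ω => B (k, ω)) (Z' k) = 0) :
    cmi (timeShare n μ) A B Z = 0 := by
  have hsum : ∑ k, cmi μ (fun ω => A (k, ω)) (fun ω => B (k, ω)) (Z' k) = 0 := by simp [h]
  simp only [cmi, Finset.sum_sub_distrib, Finset.sum_add_distrib] at hsum ⊢
  rw [H_timeShare hn hμ Z' hZ,
    H_timeShare hn hμ (fun k ω => (A (k, ω), Z' k ω)) (by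
      rintro ⟨k, ω⟩ ⟨j, ω'⟩; simp only [Prod.mk.injEq, hZ]; grind),
    H_timeShare hn hμ (fun k ω => (B (k, ω), Z' k ω)) (by
      rintro ⟨k, ω⟩ ⟨j, ω'⟩; simp only [Prod.mk.injEq, hZ]; grind),
    H_timeShare hn hμ (fun k ω => (A (k, ω), B (k, ω), Z' k ω)) (by
      rintro ⟨k, ω⟩ ⟨j, ω'⟩; simp only [Prod.mk.injEq, hZ]; grind)]
  field_simp
  linarith

lemma H_letters_close {q : α → ℝ} (hq : IsPMF q) (hμ : IsPMF μ) {W : Ω → Fin n → α} {ε : ℝ}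
    (h : l1dist (distr μ W) (fun w => ∏ k, q (w k)) ≤ ε) (g : α → β) :
    |H μ (fun ω k => g (W ω k)) - n * H q g| ≤
      (ε * (1 + n * Real.log (Fintype.card β)) + 1) / Real.log 2 := by
  have hQ : distr (fun w : Fin n → α => ∏ k, q (w k)) (fun w k => g (w k)) =
      fun v => ∏ k, distr q g (v k) := distr_prod (fun _ => q) (fun _ => g)
  have hQ' : entFun (distr (fun w : Fin n → α => ∏ k, q (w k)) (fun w k => g (w k))) =
      n * H q g := by
    rw [hQ, entFun_prod (fun _ => (isPMF_distr hq g).2)]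
    simp [H]
  have hQp : IsPMF (fun w : Fin n → α => ∏ k, q (w k)) := by
    refine ⟨fun w => Finset.prod_nonneg fun k _ => hq.1 _, ?_⟩
    have := Finset.prod_univ_sum (fun _ : Fin n => (univ : Finset α)) (fun _ a => q a)
    rw [Fintype.piFinset_univ] at this
    rw [← this]
    simp [hq.2]
  have hP : distr (distr μ W) (fun w k => g (w k)) = distr μ (fun ω k => g (W ω k)) :=
    distr_distr μ W _
  have hd : l1dist (distr μ (fun ω k => g (W ω k)))
      (distr (fun w : Fin n → α => ∏ k, q (w k)) (fun w k => g (w k))) ≤ ε := by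
    rw [← hP]
    exact (l1dist_distr_le _ _ _).trans h
  have hd' : l1dist (distr (fun w : Fin n → α => ∏ k, q (w k)) (fun w k => g (w k)))
      (distr μ (fun ω k => g (W ω k))) ≤ ε := by
    simpa only [l1dist, abs_sub_comm] using hd
  have h1 := entFun_le_of_l1dist_le (isPMF_distr hμ _) (isPMF_distr hQp _) hd
  have h2 := entFun_le_of_l1dist_le (isPMF_distr hQp _) (isPMF_distr hμ _) hd'
  rw [hQ'] at h1 h2
  simp only [Fintype.card_fun, Fintype.card_fin, Nat.cast_pow, Real.log_pow] at h1 h2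
  change |entFun _ - n * H q g| ≤ _
  rw [abs_le]
  constructor <;> linarith

end TimeSharing

section SingleLetter

variable {n : ℕ} {m₁ m₂ : Type*} [Fintype Ω] [Fintype m₁] [DecidableEq m₁] [Fintype m₂]
  [DecidableEq m₂]
  [Fintype 𝒳₁] [DecidableEq 𝒳₁] [Fintype 𝒳₂] [DecidableEq 𝒳₂]
  [Fintype 𝒴₁] [DecidableEq 𝒴₁] [Fintype 𝒴₂] [DecidableEq 𝒴₂]
  {q : 𝒳₁ × 𝒳₂ × 𝒴₁ × 𝒴₂ → ℝ} {μ : Ω → ℝ}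

lemma srcMarg_eq (q : 𝒳₁ × 𝒳₂ × 𝒴₁ × 𝒴₂ → ℝ) :
    srcMarg q = distr q (fun a => (a.1, a.2.1)) := by
  funext x
  obtain ⟨x₁, x₂⟩ := x
  simp only [srcMarg, distr, Fintype.sum_prod_type, Prod.mk.injEq]
  rw [Finset.sum_eq_single x₁ (by simp +contextual) (by simp)]
  rw [Finset.sum_eq_single x₂ (by simp +contextual) (by simp)]
  simp

/-- A joint pmf `p` of `(U, X₁, X₂, Y₁, Y₂)` satisfying the information-theoretic constraints
of the single-letter region for `q`. -/
structure Feasible {𝒰 : Type} [Fintype 𝒰] [DecidableEq 𝒰] (q : 𝒳₁ × 𝒳₂ × 𝒴₁ × 𝒴₂ → ℝ)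
    (p : 𝒰 × 𝒳₁ × 𝒳₂ × 𝒴₁ × 𝒴₂ → ℝ) : Prop where
  pmf : IsPMF p
  info : cmi p (fun a => a.2.1) (fun a => a.2.2.1) (fun a => a.1) ≤
    mi q (fun a => a.1) (fun a => a.2.1)
  markov₁ : cmi p (fun a => a.2.2.2.1) (fun a => (a.2.2.1, a.2.2.2.2))
    (fun a => (a.1, a.2.1)) = 0
  markov₂ : cmi p (fun a => a.2.2.2.2) (fun a => (a.2.1, a.2.2.2.1))
    (fun a => (a.1, a.2.2.1)) = 0

/-- The rate `I(X₁; U | X₂)`. -/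
def rate₁ {𝒰 : Type} [Fintype 𝒰] [DecidableEq 𝒰] (p : 𝒰 × 𝒳₁ × 𝒳₂ × 𝒴₁ × 𝒴₂ → ℝ) : ℝ :=
  cmi p (fun a => a.2.1) (fun a => a.1) (fun a => a.2.2.1)

/-- The rate `I(X₂; U | X₁)`. -/
def rate₂ {𝒰 : Type} [Fintype 𝒰] [DecidableEq 𝒰] (p : 𝒰 × 𝒳₁ × 𝒳₂ × 𝒴₁ × 𝒴₂ → ℝ) : ℝ :=
  cmi p (fun a => a.2.2.1) (fun a => a.1) (fun a => a.2.1)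

/-- The correlation `I(Y₁; Y₂ | X₁, X₂)` of the outputs under `q`. -/
def outputCorr (q : 𝒳₁ × 𝒳₂ × 𝒴₁ × 𝒴₂ → ℝ) : ℝ :=
  cmi q (fun a => a.2.2.1) (fun a => a.2.2.2) (fun a => (a.1, a.2.1))

lemma outputCorr_le {X₁ : Ω → Fin n → 𝒳₁} {X₂ : Ω → Fin n → 𝒳₂}
    {Y₁ : Ω → Fin n → 𝒴₁} {Y₂ : Ω → Fin n → 𝒴₂} (hq : IsPMF q) (hμ : IsPMF μ) {ε : ℝ}
    (hX : distr μ (fun ω k => (X₁ ω k, X₂ ω k)) = fun w => ∏ k, srcMarg q (w k))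
    (h : l1dist (distr μ (fun ω k => (X₁ ω k, X₂ ω k, Y₁ ω k, Y₂ ω k)))
      (fun w => ∏ k, q (w k)) ≤ ε) :
    n * outputCorr q ≤ cmi μ Y₁ Y₂ (fun ω => (X₁ ω, X₂ ω)) +
      ((ε * (1 + n * Real.log (Fintype.card (𝒴₁ × 𝒳₁ × 𝒳₂))) + 1) / Real.log 2 +
      (ε * (1 + n * Real.log (Fintype.card (𝒴₂ × 𝒳₁ × 𝒳₂))) + 1) / Real.log 2 +
      (ε * (1 + n * Real.log (Fintype.card (𝒴₁ × 𝒴₂ × 𝒳₁ × 𝒳₂))) + 1) / Real.log 2) := by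
  have h1 := H_letters_close hq hμ h (fun a => (a.2.2.1, a.1, a.2.1))
  have h2 := H_letters_close hq hμ h (fun a => (a.2.2.2, a.1, a.2.1))
  have h3 := H_letters_close hq hμ h (fun a => (a.2.2.1, a.2.2.2, a.1, a.2.1))
  have h4 : H μ (fun ω => (X₁ ω, X₂ ω)) = n * H q (fun a => (a.1, a.2.1)) := by
    have := H_iid (by rw [srcMarg_eq]; exact isPMF_distr hq _) hX (fun _ a => a)
    simp only [Finset.sum_const, Finset.card_univ, Fintype.card_fin, nsmul_eq_mul] at this
    rw [srcMarg_eq, H_distr] at this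
    rw [← this]
    refine H_congr ?_ ?_ <;>
    · intro ω ω' h h' e
      simp only [Prod.mk.injEq, funext_iff] at *; grind
  have e1 : H μ (fun ω k => (Y₁ ω k, X₁ ω k, X₂ ω k)) = H μ (fun ω => (Y₁ ω, X₁ ω, X₂ ω)) := by
    refine H_congr ?_ ?_ <;>
    · intro ω ω' h h' e
      simp only [Prod.mk.injEq, funext_iff] at *; grind
  have e2 : H μ (fun ω k => (Y₂ ω k, X₁ ω k, X₂ ω k)) = H μ (fun ω => (Y₂ ω, X₁ ω, X₂ ω)) := by
    refine H_congr ?_ ?_ <;>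
    · intro ω ω' h h' e
      simp only [Prod.mk.injEq, funext_iff] at *; grind
  have e3 : H μ (fun ω k => (Y₁ ω k, Y₂ ω k, X₁ ω k, X₂ ω k)) =
      H μ (fun ω => (Y₁ ω, Y₂ ω, X₁ ω, X₂ ω)) := by
    refine H_congr ?_ ?_ <;>
    · intro ω ω' h h' e
      simp only [Prod.mk.injEq, funext_iff] at *; grind
  rw [e1] at h1
  rw [e2] at h2
  rw [e3] at h3
  have h1 := (abs_le.1 h1).1
  have h2 := (abs_le.1 h2).1
  have h3 := (abs_le.1 h3).2
  simp only [outputCorr, cmi, h4]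
  linarith

set_option synthInstance.maxSize 1000 in
set_option synthInstance.maxHeartbeats 100000 in
lemma Interactive.exists_feasible {γ : Type} [Fintype γ] [DecidableEq γ]
    {X₁ : Ω → Fin n → 𝒳₁} {X₂ : Ω → Fin n → 𝒳₂} {M₁ : Ω → m₁} {M₂ : Ω → m₂}
    {C : ℕ → Ω → γ} {r : ℕ} {Y₁ : Ω → Fin n → 𝒴₁} {Y₂ : Ω → Fin n → 𝒴₂}
    (P : Interactive μ X₁ X₂ M₁ M₂ C r Y₁ Y₂) (hn : 0 < n) (hq : IsPMF q) {ε R12 R21 : ℝ}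
    (hX : distr μ (fun ω k => (X₁ ω k, X₂ ω k)) = fun w => ∏ k, srcMarg q (w k))
    (h : l1dist (distr μ (fun ω k => (X₁ ω k, X₂ ω k, Y₁ ω k, Y₂ ω k)))
      (fun w => ∏ k, q (w k)) ≤ ε)
    (h1 : H μ (fun ω => (C r ω, X₂ ω, M₂ ω)) - H μ (fun ω => (X₂ ω, M₂ ω)) ≤ n * R12)
    (h2 : H μ (fun ω => (C r ω, X₁ ω, M₁ ω)) - H μ (fun ω => (X₁ ω, M₁ ω)) ≤ n * R21)
    (h3 : H μ (C r) ≤ n * (R12 + R21)) :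
    ∃ (𝒰 : Type) (_ : Fintype 𝒰) (_ : DecidableEq 𝒰) (p : 𝒰 × 𝒳₁ × 𝒳₂ × 𝒴₁ × 𝒴₂ → ℝ),
      Feasible q p ∧ (∀ w, |∑ u, p (u, w) - q w| ≤ ε) ∧ rate₁ p ≤ R12 ∧ rate₂ p ≤ R21 ∧
      n * (rate₁ p + rate₂ p) + cmi μ Y₁ Y₂ (fun ω => (X₁ ω, X₂ ω)) ≤ n * (R12 + R21) := by
  have hn' : (0 : ℝ) < n := by exact_mod_cast hn
  have hs : IsPMF (srcMarg q) := by rw [srcMarg_eq]; exact isPMF_distr hq _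
  set ν := timeShare n μ with hν
  have hνp : IsPMF ν := isPMF_timeShare hn P.pmf
  let U : Fin n × Ω → Fin n × γ × (Fin n → Option 𝒳₁) × (Fin n → Option 𝒳₂) :=
    fun a => (a.1, C r a.2, below a.1 (X₁ a.2), above (a.1 + 1) (X₂ a.2))
  set Φ : Fin n × Ω → _ := fun a => (U a, X₁ a.2 a.1, X₂ a.2 a.1, Y₁ a.2 a.1, Y₂ a.2 a.1) with hΦ
  -- the four entropies along the chain
  set A : ℕ → ℝ := fun t => H μ (fun ω => (C r ω, below t (X₁ ω), above t (X₂ ω))) with hA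
  set B : ℕ → ℝ := fun t => H μ (fun ω => (C r ω, below t (X₁ ω), above (t + 1) (X₂ ω))) with hB
  set D : ℕ → ℝ := fun t => H μ (fun ω => (C r ω, below (t + 1) (X₁ ω), above t (X₂ ω))) with hD
  have hU : H ν U = Real.logb 2 n + (∑ k : Fin n, B k) / n :=
    H_timeShare hn P.pmf (fun k ω => (C r ω, below k (X₁ ω), above (k + 1) (X₂ ω))) (by
      rintro ⟨k, ω⟩ ⟨j, ω'⟩
      simp only [U, Prod.mk.injEq])
  have hUX₁ : ∀ {β : Type _} [Fintype β] [DecidableEq β] (Z : Fin n × Ω → β)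
      (_ : ∀ a b, Z a = Z b ↔ (X₁ a.2 a.1, U a) = (X₁ b.2 b.1, U b)),
      H ν Z = Real.logb 2 n + (∑ k : Fin n, A (k + 1)) / n := fun Z hZ =>
    H_timeShare hn P.pmf (fun k ω => (C r ω, below (k + 1) (X₁ ω), above (k + 1) (X₂ ω))) (by
      rintro ⟨k, ω⟩ ⟨j, ω'⟩
      have := below_succ_iff (x := X₁ ω) (y := X₁ ω') k
      simp only [hZ, U, Prod.mk.injEq]
      grind)
  have hUX₂ : ∀ {β : Type _} [Fintype β] [DecidableEq β] (Z : Fin n × Ω → β)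
      (_ : ∀ a b, Z a = Z b ↔ (X₂ a.2 a.1, U a) = (X₂ b.2 b.1, U b)),
      H ν Z = Real.logb 2 n + (∑ k : Fin n, A k) / n := fun Z hZ =>
    H_timeShare hn P.pmf (fun k ω => (C r ω, below k (X₁ ω), above k (X₂ ω))) (by
      rintro ⟨k, ω⟩ ⟨j, ω'⟩
      have := above_iff_succ (x := X₂ ω) (y := X₂ ω') k
      simp only [hZ, U, Prod.mk.injEq]
      grind)
  have hUXX : ∀ {β : Type _} [Fintype β] [DecidableEq β] (Z : Fin n × Ω → β)
      (_ : ∀ a b, Z a = Z b ↔ (X₁ a.2 a.1, X₂ a.2 a.1, U a) = (X₁ b.2 b.1, X₂ b.2 b.1, U b)),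
      H ν Z = Real.logb 2 n + (∑ k : Fin n, D k) / n := fun Z hZ =>
    H_timeShare hn P.pmf (fun k ω => (C r ω, below (k + 1) (X₁ ω), above k (X₂ ω))) (by
      rintro ⟨k, ω⟩ ⟨j, ω'⟩
      have := below_succ_iff (x := X₁ ω) (y := X₁ ω') k
      have := above_iff_succ (x := X₂ ω) (y := X₂ ω') k
      simp only [hZ, U, Prod.mk.injEq]
      grind)
  -- marginal entropies of the source
  have hsrc : distr ν (fun a => (X₁ a.2 a.1, X₂ a.2 a.1)) = srcMarg q :=
    distr_timeShare_const hn fun k => distr_iid hs hX k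
  have hsrcH : ∀ {β : Type _} [Fintype β] [DecidableEq β] (g : 𝒳₁ × 𝒳₂ → β),
      H ν (fun a => g (X₁ a.2 a.1, X₂ a.2 a.1)) = H (srcMarg q) g := fun g => by
    rw [← hsrc, H_distr]
  have hsrcn : ∀ {β : Type _} [Fintype β] [DecidableEq β] (g : 𝒳₁ × 𝒳₂ → β),
      H μ (fun ω k => g (X₁ ω k, X₂ ω k)) = n * H (srcMarg q) g := fun g => by
    have := H_iid hs hX (fun _ : Fin n => g)
    simpa using this
  have hX1 : H μ X₁ = n * H (srcMarg q) Prod.fst := hsrcn Prod.fst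
  have hX2 : H μ X₂ = n * H (srcMarg q) Prod.snd := hsrcn Prod.snd
  have hX12 : H μ (fun ω => (X₁ ω, X₂ ω)) = n * H (srcMarg q) (fun a => (a.1, a.2)) := by
    rw [← hsrcn]
    refine H_congr ?_ ?_ <;>
    · intro ω ω' h h' e
      simp only [Prod.mk.injEq, funext_iff] at *; grind
  have hq1 : H q (fun a => a.1) = H (srcMarg q) Prod.fst := by rw [srcMarg_eq, H_distr]
  have hq2 : H q (fun a => a.2.1) = H (srcMarg q) Prod.snd := by rw [srcMarg_eq, H_distr]
  have hq12 : H q (fun a => (a.1, a.2.1)) = H (srcMarg q) (fun a => (a.1, a.2)) := by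
    rw [srcMarg_eq, H_distr]
  -- sums along the chain
  have hA0 : A 0 = H μ (fun ω => (C r ω, X₂ ω)) := by
    refine H_congr ?_ ?_ <;>
    · intro ω ω' h h' e
      have := below_zero (X₁ ω) (X₁ ω')
      simp only [Prod.mk.injEq, above_zero] at *; grind
  have hAn : A n = H μ (fun ω => (C r ω, X₁ ω)) := by
    refine H_congr ?_ ?_ <;>
    · intro ω ω' h h' e
      have := above_full (X₂ ω) (X₂ ω')
      simp only [Prod.mk.injEq, below_full] at *; grind
  have hge : H μ (fun ω => (C r ω, X₁ ω, X₂ ω)) - H μ (fun ω => (C r ω, X₁ ω)) ≤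
      ∑ k : Fin n, (D k - A (k + 1)) := sum_letters_ge P.pmf.1 (C r)
  have hle : ∑ k : Fin n, (A k - B k) ≤ H μ (fun ω => (C r ω, X₂ ω)) - H μ (C r) :=
    sum_letters_le P.pmf.1 (C r)
  have htel : ∑ k : Fin n, (A (k + 1) - A k) = A n - A 0 := by
    rw [Fin.sum_univ_eq_sum_range (fun k => A (k + 1) - A k) n, Finset.sum_range_sub]
  simp only [Finset.sum_sub_distrib] at hge hle htel
  have hi1 := P.info_le₁
  have hi2 := P.info_le₂
  have hsum := P.sum_info_le
  have hscmi := P.source_cmi_le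
  have hr1 : n * rate₁ (distr ν Φ) = H μ (fun ω => (X₁ ω, X₂ ω)) - H μ X₂ +
      (∑ k : Fin n, A k - ∑ k : Fin n, D k) := by
    simp only [rate₁, cmi, H_distr, hΦ]
    rw [hsrcH (fun x => (x.1, x.2)), hsrcH Prod.snd, hUX₂ _ (by intro a b; grind),
      hUXX _ (by intro a b; grind), hX12, hX2]
    field_simp
    ring
  have hr2 : n * rate₂ (distr ν Φ) = H μ (fun ω => (X₁ ω, X₂ ω)) - H μ X₁ +
      (∑ k : Fin n, A (k + 1) - ∑ k : Fin n, D k) := by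
    have hsw : H ν (fun a => (X₂ a.2 a.1, X₁ a.2 a.1)) = H (srcMarg q) (fun x => (x.1, x.2)) := by
      rw [hsrcH (fun x => (x.2, x.1))]
      refine H_congr ?_ ?_ <;>
      · intro ω ω' h h' e
        simp only [Prod.mk.injEq] at *; grind
    simp only [rate₂, cmi, H_distr, hΦ]
    rw [hsw, hsrcH Prod.fst, hUX₁ _ (by intro a b; grind),
      hUXX _ (by intro a b; grind), hX12, hX1]
    field_simp
    ring
  refine ⟨_, _, inferInstance, distr ν Φ, ⟨isPMF_distr hνp Φ, ?_, ?_, ?_⟩, ?_, ?_, ?_, ?_⟩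
  · simp only [cmi, mi, H_distr, hΦ]
    rw [hUX₁ _ (by intro a b; grind), hUX₂ _ (by intro a b; grind),
      hUXX _ (by intro a b; grind), hU, hq1, hq2, hq12]
    rw [hX1, hX2, hX12] at hscmi
    refine le_of_mul_le_mul_left ?_ hn'
    have : n * (Real.logb 2 n + (∑ k : Fin n, A (k + 1)) / n +
        (Real.logb 2 n + (∑ k : Fin n, A k) / n) - (Real.logb 2 n + (∑ k : Fin n, D k) / n) -
        (Real.logb 2 n + (∑ k : Fin n, B k) / n)) =
      ∑ k : Fin n, A (k + 1) + ∑ k : Fin n, A k - ∑ k : Fin n, D k - ∑ k : Fin n, B k := by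
      field_simp
      ring
    rw [this]
    linarith
  · have hcmi := cmi_timeShare_eq_zero (A := fun a : Fin n × Ω => Y₁ a.2 a.1)
      (B := fun a => (X₂ a.2 a.1, Y₂ a.2 a.1)) (Z := fun a => (U a, X₁ a.2 a.1)) hn P.pmf
      (fun k ω => (C r ω, below (k + 1) (X₁ ω), above (k + 1) (X₂ ω))) (by
        rintro ⟨k, ω⟩ ⟨j, ω'⟩
        have := below_succ_iff (x := X₁ ω) (y := X₁ ω') k
        simp only [U, Prod.mk.injEq]
        grind) fun k => by
      refine P.cmi_eq_zero (V := fun ω => (below (k + 1) (X₁ ω), above (k + 1) (X₂ ω)))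
        ?_ (masks_separate hs hX _) ?_ ?_
      · intro ω ω' h h' e
        simp only [Prod.mk.injEq] at *; grind
      · intro ω ω' h h' e
        have := P.out₁ ω ω' h h'
        simp only [Prod.mk.injEq] at *; grind
      · intro ω ω' h h' e
        have := P.out₂ ω ω' h h'
        simp only [Prod.mk.injEq] at *; grind
    simpa only [cmi, H_distr, hΦ] using hcmi
  · have hcmi := cmi_timeShare_eq_zero (A := fun a : Fin n × Ω => Y₂ a.2 a.1)
      (B := fun a => (X₁ a.2 a.1, Y₁ a.2 a.1)) (Z := fun a => (U a, X₂ a.2 a.1)) hn P.pmf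
      (fun k ω => (C r ω, below k (X₁ ω), above k (X₂ ω))) (by
        rintro ⟨k, ω⟩ ⟨j, ω'⟩
        have := above_iff_succ (x := X₂ ω) (y := X₂ ω') k
        simp only [U, Prod.mk.injEq]
        grind) fun k => by
      rw [cmi_comm]
      refine P.cmi_eq_zero (V := fun ω => (below k (X₁ ω), above k (X₂ ω)))
        ?_ (masks_separate hs hX _) ?_ ?_
      · intro ω ω' h h' e
        simp only [Prod.mk.injEq] at *; grind
      · intro ω ω' h h' e
        have := P.out₁ ω ω' h h'
        simp only [Prod.mk.injEq] at *; grind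
      · intro ω ω' h h' e
        have := P.out₂ ω ω' h h'
        simp only [Prod.mk.injEq] at *; grind
    simpa only [cmi, H_distr, hΦ] using hcmi
  · intro w
    rw [distr_pair_sum ν U (fun a => (X₁ a.2 a.1, X₂ a.2 a.1, Y₁ a.2 a.1, Y₂ a.2 a.1)) w,
      distr_timeShare]
    have hk : ∀ k : Fin n,
        |distr μ (fun ω => (X₁ ω k, X₂ ω k, Y₁ ω k, Y₂ ω k)) w - q w| ≤ ε := fun k => by
      have hd := (l1dist_distr_le _ _ (fun v : Fin n → 𝒳₁ × 𝒳₂ × 𝒴₁ × 𝒴₂ => v k)).trans h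
      rw [distr_distr, distr_iid (W := fun v => v) hq (by
        funext v; simp [distr]) k] at hd
      exact (abs_sub_le_l1dist _ _ w).trans hd
    have he : (∑ k : Fin n, distr μ (fun ω => (X₁ ω k, X₂ ω k, Y₁ ω k, Y₂ ω k)) w) / n - q w =
        (∑ k : Fin n, (distr μ (fun ω => (X₁ ω k, X₂ ω k, Y₁ ω k, Y₂ ω k)) w - q w)) / n := by
      rw [Finset.sum_sub_distrib]
      simp only [Finset.sum_const, Finset.card_univ, Fintype.card_fin, nsmul_eq_mul]
      field_simp
    rw [he, abs_div, abs_of_pos hn', div_le_iff₀ hn']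
    refine (Finset.abs_sum_le_sum_abs _ _).trans ((Finset.sum_le_sum fun k _ => hk k).trans ?_)
    simp [mul_comm]
  · refine le_of_mul_le_mul_left ?_ hn'
    rw [hr1]; linarith
  · refine le_of_mul_le_mul_left ?_ hn'
    rw [hr2]; linarith
  · rw [mul_add, hr1, hr2]; linarith

end SingleLetter

section Transcript

variable {r : ℕ} {𝓒 : Fin r → Type} {δ : Type*} [Fintype Ω] [∀ i, Fintype (𝓒 i)]
  [∀ i, DecidableEq (𝓒 i)] [Fintype δ] [DecidableEq δ] {μ : Ω → ℝ}

/-- The first `t` messages of an exchange, masked to a fixed alphabet. -/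
def transcript (C : (i : Fin r) → Ω → 𝓒 i) (t : ℕ) (ω : Ω) : (i : Fin r) → Option (𝓒 i) :=
  fun i => if (i : ℕ) < t then some (C i ω) else none

lemma transcript_eq_iff {C : (i : Fin r) → Ω → 𝓒 i} {t : ℕ} {ω ω' : Ω} :
    transcript C t ω = transcript C t ω' ↔ ∀ i : Fin r, (i : ℕ) < t → C i ω = C i ω' := by
  simp only [funext_iff, transcript]
  refine forall_congr' fun i => ?_
  by_cases h : (i : ℕ) < t <;> simp [h]

lemma transcript_step {δ' : Type*} {C : (i : Fin r) → Ω → 𝓒 i} {Z : Ω → δ'} (t : ℕ)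
    (h : ∀ i : Fin r, (i : ℕ) = t →
      Det μ (fun ω => ((fun j : Fin (i : ℕ) => C ⟨j.1, j.2.trans i.2⟩ ω), Z ω)) (C i)) :
    Det μ (fun ω => (Z ω, transcript C t ω)) (transcript C (t + 1)) := by
  intro ω ω' h0 h0' e
  simp only [Prod.mk.injEq, transcript_eq_iff] at e
  refine transcript_eq_iff.2 fun i hi => ?_
  rcases Nat.lt_succ_iff_lt_or_eq.1 hi with hi | hi
  · exact e.2 i hi
  · exact h i hi ω ω' h0 h0' (Prod.ext (funext fun j => e.2 _ (hi ▸ j.2)) e.1)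

lemma H_transcript_le (hμ : IsPMF μ) {C : (i : Fin r) → Ω → 𝓒 i} {Z : Ω → δ}
    (S : ℕ → Prop) [DecidablePred S]
    (h : ∀ t, ¬ S t → Det μ (fun ω => (Z ω, transcript C t ω)) (transcript C (t + 1))) :
    H μ (fun ω => (transcript C r ω, Z ω)) ≤
      H μ Z + ∑ i ∈ univ.filter (fun i : Fin r => S i), H μ (C i) := by
  set a : ℕ → ℝ := fun t => if S t then if ht : t < r then H μ (C ⟨t, ht⟩) else 0 else 0 with ha
  have hsum : ∑ i ∈ univ.filter (fun i : Fin r => S i), H μ (C i) = ∑ t ∈ range r, a t := by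
    rw [← Fin.sum_univ_eq_sum_range, Finset.sum_filter]
    simp [ha]
  rw [hsum]
  refine H_chain (fun ω ω' => transcript_eq_iff.2 (by simp)) a (fun t => ?_) r
  by_cases hS : S t
  · by_cases ht : t < r
    · simp only [ha, hS, ht, if_true, dif_pos]
      refine H_pair_le hμ fun ω ω' h0 h0' e => ?_
      simp only [Prod.mk.injEq, transcript_eq_iff] at e ⊢
      refine ⟨fun i hi => ?_, e.1.2⟩
      rcases Nat.lt_succ_iff_lt_or_eq.1 hi with hi | hi
      · exact e.1.1 i hi
      · have : i = ⟨t, ht⟩ := Fin.ext hi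
        exact this ▸ e.2
    · simp only [ha, hS, ht, if_true, dif_neg, not_false_eq_true, add_zero]
      refine H_mono hμ.1 fun ω ω' h0 h0' e => ?_
      simp only [Prod.mk.injEq, transcript_eq_iff] at e ⊢
      exact ⟨fun i hi => e.1 i (by omega), e.2⟩
  · simp only [ha, hS, if_false, add_zero]
    refine H_mono hμ.1 fun ω ω' h0 h0' e => ?_
    simp only [Prod.mk.injEq] at e ⊢
    exact ⟨h t hS ω ω' h0 h0' (Prod.ext e.2 e.1), e.2⟩

end Transcript

section Achievable

variable [Fintype 𝒳₁] [DecidableEq 𝒳₁] [Fintype 𝒳₂] [DecidableEq 𝒳₂]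
  [Fintype 𝒴₁] [DecidableEq 𝒴₁] [Fintype 𝒴₂] [DecidableEq 𝒴₂]
  {q : 𝒳₁ × 𝒳₂ × 𝒴₁ × 𝒴₂ → ℝ} {r : ℕ} {R12 R21 : ℝ}

lemma distr_equiv [Fintype α] [Fintype β] [DecidableEq β] (e : α ≃ β) (P : α → ℝ) :
    distr P e = fun b => P (e.symm b) := by
  funext b
  simp only [distr]
  rw [Finset.sum_eq_single (e.symm b)]
  · simp
  · intro a _ ha
    rw [if_neg]
    rintro rfl
    simp at ha
  · simp

lemma Admissible.exists_feasible (hq : IsPMF q) (h : Admissible q r R12 R21) :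
    ∃ κ : ℝ, ∀ ε : ℝ, 0 < ε → ε ≤ 1 →
      ∃ (𝒰 : Type) (_ : Fintype 𝒰) (_ : DecidableEq 𝒰) (p : 𝒰 × 𝒳₁ × 𝒳₂ × 𝒴₁ × 𝒴₂ → ℝ),
        Feasible q p ∧ (∀ w, |∑ u, p (u, w) - q w| ≤ ε) ∧ rate₁ p ≤ R12 ∧ rate₂ p ≤ R21 ∧
        rate₁ p + rate₂ p + outputCorr q ≤ R12 + R21 + κ * ε := by
  set L₁ := Real.log (Fintype.card (𝒴₁ × 𝒳₁ × 𝒳₂))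
  set L₂ := Real.log (Fintype.card (𝒴₂ × 𝒳₁ × 𝒳₂))
  set L₃ := Real.log (Fintype.card (𝒴₁ × 𝒴₂ × 𝒳₁ × 𝒳₂))
  refine ⟨(2 + L₁) / Real.log 2 + (2 + L₂) / Real.log 2 + (2 + L₃) / Real.log 2,
    fun ε hε hε1 => ?_⟩
  obtain ⟨n₀, hn₀⟩ := h ε hε
  obtain ⟨n, hn⟩ : ∃ n : ℕ, max (n₀ : ℝ) (1 / ε) ≤ n := exists_nat_ge _
  obtain ⟨hnn, hnε⟩ := max_le_iff.1 hn
  obtain ⟨Ω, 𝓜₁, 𝓜₂, 𝓒, _, _, _, _, _, _, _, _, μ, X₁, X₂, M₁, M₂, C, Y₁, Y₂, hμ, hX, hM, he, ho,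
    hr1, hr2, hy1, hy2, htv⟩ := hn₀ n (by exact_mod_cast hnn)
  have hnε : 1 ≤ n * ε := by rwa [div_le_iff₀ hε] at hnε
  have hn1 : (1 : ℝ) ≤ n := by nlinarith
  have hn0 : 0 < n := by exact_mod_cast (by linarith : (0 : ℝ) < n)
  have hs₁ : ∀ t, t % 2 = 0 →
      Det μ (fun ω => ((X₁ ω, M₁ ω), transcript C t ω)) (transcript C (t + 1)) := fun t ht =>
    transcript_step t fun i hi => det_of_condEnt_eq_zero hμ.1 (he i (hi ▸ ht))
  have hs₂ : ∀ t, t % 2 = 1 →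
      Det μ (fun ω => ((X₂ ω, M₂ ω), transcript C t ω)) (transcript C (t + 1)) := fun t ht =>
    transcript_step t fun i hi => det_of_condEnt_eq_zero hμ.1 (ho i (hi ▸ ht))
  have P : Interactive μ X₁ X₂ M₁ M₂ (transcript C) r Y₁ Y₂ :=
    { pmf := hμ
      indep := hM
      start := fun ω ω' => transcript_eq_iff.2 (by simp)
      prev := fun t ω ω' _ _ e =>
        transcript_eq_iff.2 fun i hi => transcript_eq_iff.1 e i (by omega)
      even := hs₁
      odd := hs₂
      out₁ := fun ω ω' h0 h0' e => by
        simp only [Prod.mk.injEq, transcript_eq_iff] at e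
        exact det_of_condEnt_eq_zero hμ.1 hy1 ω ω' h0 h0'
          (Prod.ext e.1.1 (Prod.ext e.1.2 (funext fun i => e.2 i i.2)))
      out₂ := fun ω ω' h0 h0' e => by
        simp only [Prod.mk.injEq, transcript_eq_iff] at e
        exact det_of_condEnt_eq_zero hμ.1 hy2 ω ω' h0 h0'
          (Prod.ext e.1.1 (Prod.ext e.1.2 (funext fun i => e.2 i i.2))) }
  have hc₁ := H_transcript_le (Z := fun ω => (X₂ ω, M₂ ω)) hμ (fun t => t % 2 = 0)
    fun t ht => hs₂ t (by omega)
  have hc₂ := H_transcript_le (Z := fun ω => (X₁ ω, M₁ ω)) hμ (fun t => t % 2 = 1)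
    fun t ht => hs₁ t (by omega)
  have hc₃ := H_transcript_le (C := C) (Z := fun _ => ()) hμ (fun _ => True)
    fun t ht => absurd trivial ht
  rw [H_const hμ (X := fun _ => ()) (fun _ _ => rfl)] at hc₃
  have hsplit : ∑ i, H μ (C i) = ∑ i ∈ univ.filter (fun i : Fin r => (i : ℕ) % 2 = 0), H μ (C i) +
      ∑ i ∈ univ.filter (fun i : Fin r => (i : ℕ) % 2 = 1), H μ (C i) := by
    rw [← Finset.sum_filter_add_sum_filter_not univ (fun i : Fin r => (i : ℕ) % 2 = 0)]
    simp
  have hunit : H μ (fun ω => (transcript C r ω, ())) = H μ (transcript C r) := by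
    refine H_congr ?_ ?_ <;>
    · intro ω ω' h h' e
      simp only [Prod.mk.injEq] at *; grind
  simp only [Finset.filter_true, zero_add, hunit, hsplit] at hc₃
  let e₂ : (Fin n → 𝒳₁) × (Fin n → 𝒳₂) ≃ (Fin n → 𝒳₁ × 𝒳₂) :=
    ⟨fun x k => (x.1 k, x.2 k), fun v => (fun k => (v k).1, fun k => (v k).2),
      fun _ => rfl, fun _ => rfl⟩
  let e₄ : (Fin n → 𝒳₁) × (Fin n → 𝒳₂) × (Fin n → 𝒴₁) × (Fin n → 𝒴₂) ≃
      (Fin n → 𝒳₁ × 𝒳₂ × 𝒴₁ × 𝒴₂) :=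
    ⟨fun x k => (x.1 k, x.2.1 k, x.2.2.1 k, x.2.2.2 k),
      fun v => (fun k => (v k).1, fun k => (v k).2.1, fun k => (v k).2.2.1, fun k => (v k).2.2.2),
      fun _ => rfl, fun _ => rfl⟩
  have hX' : distr μ (fun ω k => (X₁ ω k, X₂ ω k)) = fun w => ∏ k, srcMarg q (w k) := by
    have := distr_distr μ (fun ω => (X₁ ω, X₂ ω)) e₂
    rw [hX, distr_equiv] at this
    exact this.symm
  have htv' : l1dist (distr μ (fun ω k => (X₁ ω k, X₂ ω k, Y₁ ω k, Y₂ ω k)))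
      (fun w => ∏ k, q (w k)) ≤ ε := by
    have := (l1dist_distr_le _ _ e₄).trans htv
    rwa [distr_distr, distr_equiv] at this
  obtain ⟨𝒰, _, _, p, hp, hpq, hp1, hp2, hp3⟩ := P.exists_feasible hn0 hq hX' htv'
    (R12 := R12) (R21 := R21) (by linarith) (by linarith) (by linarith)
  refine ⟨𝒰, _, _, p, hp, hpq, hp1, hp2, ?_⟩
  have hoc := outputCorr_le hq hμ hX' htv'
  have hl2 : 0 < Real.log 2 := Real.log_pos one_lt_two
  have hb : ∀ L : ℝ, (ε * (1 + n * L) + 1) / Real.log 2 ≤ n * ((2 + L) / Real.log 2 * ε) :=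
    fun L => by
      rw [div_mul_eq_mul_div, mul_div_assoc', div_le_div_iff_of_pos_right hl2]
      nlinarith
  have b₁ := hb L₁
  have b₂ := hb L₂
  have b₃ := hb L₃
  refine le_of_mul_le_mul_left ?_ (by linarith : (0 : ℝ) < n)
  linarith

end Achievable

section Reduction

/-- A nonnegative weight vector can be replaced by one of small support, preserving finitely many
linear functionals and not increasing a linear cost, provided that no nonzero nonnegative vector
supported on the original support is annihilated by all the functionals. -/
lemma exists_card_support_le {𝒰 ι : Type*} [Fintype 𝒰] [Fintype ι] (a : ι → 𝒰 → ℝ) (c : 𝒰 → ℝ)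
    (t : 𝒰 → ℝ) (ht : ∀ u, 0 ≤ t u)
    (h : ∀ v : 𝒰 → ℝ, (∀ u, 0 ≤ v u) → (∀ u, t u = 0 → v u = 0) →
      (∀ i, ∑ u, v u * a i u = 0) → v = 0) :
    ∃ t' : 𝒰 → ℝ, (∀ u, 0 ≤ t' u) ∧ (∀ u, t u = 0 → t' u = 0) ∧
      (∀ i, ∑ u, t' u * a i u = ∑ u, t u * a i u) ∧ ∑ u, t' u * c u ≤ ∑ u, t u * c u ∧
      (univ.filter (fun u => t' u ≠ 0)).card ≤ Fintype.card ι := by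
  classical
  induction hk : (univ.filter (fun u => t u ≠ 0)).card using Nat.strong_induction_on
    generalizing t with
  | _ k ih =>
  by_cases hle : k ≤ Fintype.card ι
  · exact ⟨t, ht, fun _ hu => hu, fun _ => rfl, le_rfl, hk ▸ hle⟩
  obtain ⟨v, hv0, hvs, hva⟩ : ∃ v : 𝒰 → ℝ, v ≠ 0 ∧ (∀ u, t u = 0 → v u = 0) ∧
      ∀ i, ∑ u, v u * a i u = 0 := by
    have hdep : ¬ LinearIndependent ℝ (fun (u : {u // t u ≠ 0}) (i : ι) => a i u) := fun hli => by
      have := hli.fintype_card_le_finrank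
      rw [Module.finrank_fintype_fun_eq_card, Fintype.card_subtype, hk] at this
      exact hle this
    obtain ⟨g, hg, u₀, hu₀⟩ := Fintype.not_linearIndependent_iff.1 hdep
    refine ⟨fun u => if hu : t u ≠ 0 then g ⟨u, hu⟩ else 0, fun h0 => hu₀ ?_, fun u hu => ?_,
      fun i => ?_⟩
    · have := congrFun h0 u₀
      simpa [u₀.2] using this
    · simp [hu]
    · have := congrFun hg i
      simp only [Finset.sum_apply, Pi.smul_apply, smul_eq_mul, Pi.zero_apply] at this
      rw [← Fintype.sum_subtype_add_sum_subtype (fun u => t u ≠ 0)]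
      refine Eq.trans ?_ this
      refine (add_eq_left.2 (Finset.sum_eq_zero fun u _ => ?_)).trans
        (Finset.sum_congr rfl fun u _ => ?_)
      · simp [not_not.1 u.2]
      · simp [u.2]
  wlog hc : ∑ u, v u * c u ≤ 0 generalizing v
  · refine this (-v) (neg_ne_zero.2 hv0) (fun u hu => by simp [hvs u hu]) (fun i => ?_) ?_
    · simpa using hva i
    · simp only [Pi.neg_apply, neg_mul, Finset.sum_neg_distrib]
      linarith
  obtain ⟨w, hw⟩ : ∃ u, v u < 0 := by
    by_contra! hcon
    exact hv0 (h v hcon hvs hva)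
  obtain ⟨m, hm, hmin⟩ := Finset.exists_min_image (univ.filter (fun u => v u < 0))
    (fun u => t u / (- v u)) ⟨w, by simpa using hw⟩
  simp only [Finset.mem_filter, Finset.mem_univ, true_and] at hm hmin
  set s := t m / (- v m) with hs
  have hs0 : 0 ≤ s := div_nonneg (ht m) (by linarith)
  have htm : t m ≠ 0 := fun h0 => by simp [hvs m h0] at hm
  have hnew : ∀ u, 0 ≤ t u + s * v u := fun u => by
    rcases lt_or_ge (v u) 0 with hu | hu
    · have := hmin u hu
      rw [le_div_iff₀ (by linarith)] at this
      linarith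
    · exact add_nonneg (ht u) (mul_nonneg hs0 hu)
  have hzero : ∀ u, t u = 0 → t u + s * v u = 0 := fun u hu => by simp [hu, hvs u hu]
  have hmz : t m + s * v m = 0 := by
    rw [hs, div_neg, neg_mul, div_mul_cancel₀ _ hm.ne]
    ring
  obtain ⟨t', h1, h2, h3, h4, h5⟩ := ih (univ.filter (fun u => t u + s * v u ≠ 0)).card (by
      rw [← hk]
      refine Finset.card_lt_card (Finset.ssubset_iff_of_subset ?_ |>.2 ⟨m, ?_, ?_⟩)
      · intro u
        simp only [Finset.mem_filter, Finset.mem_univ, true_and]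
        exact fun h1 h2 => h1 (hzero u h2)
      · simpa using htm
      · simpa using hmz)
    (fun u => t u + s * v u) hnew
    (fun v' hv' hs' => h v' hv' fun u hu => hs' u (hzero u hu)) rfl
  refine ⟨t', h1, fun u hu => h2 u (hzero u hu), fun i => ?_, ?_, h5⟩
  · rw [h3 i]
    simp only [add_mul, Finset.sum_add_distrib, mul_assoc, ← Finset.mul_sum, hva i]
    ring
  · refine h4.trans ?_
    simp only [add_mul, Finset.sum_add_distrib, mul_assoc, ← Finset.mul_sum]
    nlinarith

variable {𝒰 W : Type*} [Fintype 𝒰] [DecidableEq 𝒰] [Fintype W] [DecidableEq W]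
  [Fintype α] [Fintype β] [Fintype γ] [DecidableEq α] [DecidableEq β] [DecidableEq γ]

/-- Reweighting of the first coordinate. -/
def reweight (t : 𝒰 → ℝ) (p : 𝒰 × W → ℝ) : 𝒰 × W → ℝ := fun a => t a.1 * p a

lemma H_reweight {p : 𝒰 × W → ℝ} (hp : ∀ a, 0 ≤ p a) {t : 𝒰 → ℝ}
    {Z : 𝒰 × W → α} (f : W → β) (hZ : ∀ a b, Z a = Z b ↔ a.1 = b.1 ∧ f a.2 = f b.2) :
    H (reweight t p) Z = ∑ u, t u * H (fun w => p (u, w)) f -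
      ∑ u, t u * Real.logb 2 (t u) * ∑ w, p (u, w) := by
  have hd : ∀ u w, distr (reweight t p) Z (Z (u, w)) =
      t u * distr (fun w => p (u, w)) f (f w) := by
    intro u w
    simp only [distr, reweight, Fintype.sum_prod_type, hZ, Finset.mul_sum]
    rw [Finset.sum_eq_single u]
    · refine Finset.sum_congr rfl fun w' _ => ?_
      simp
    · intro j _ hj
      simp [hj]
    · simp
  simp only [H_eq, Fintype.sum_prod_type, hd, ← Finset.sum_sub_distrib, ← Finset.sum_neg_distrib,
    Finset.mul_sum]
  refine Finset.sum_congr rfl fun u _ => Finset.sum_congr rfl fun w _ => ?_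
  simp only [reweight]
  by_cases ht0 : t u = 0
  · simp [ht0]
  by_cases hp0 : p (u, w) = 0
  · simp [hp0]
  rw [Real.logb_mul ht0 (distr_pos (fun w => hp (u, w)) f hp0).ne']
  ring

lemma cmi_reweight {δ : Type*} [Fintype δ] [DecidableEq δ] {p : 𝒰 × W → ℝ} (hp : ∀ a, 0 ≤ p a)
    {t : 𝒰 → ℝ} (A : W → α) (B : W → β) (z : W → γ) {Z : 𝒰 × W → δ}
    (hZ : ∀ a b, Z a = Z b ↔ a.1 = b.1 ∧ z a.2 = z b.2) :
    cmi (reweight t p) (fun a => A a.2) (fun a => B a.2) Z =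
      ∑ u, t u * cmi (fun w => p (u, w)) A B z := by
  simp only [cmi]
  rw [H_reweight hp z hZ, H_reweight hp (fun w => (A w, z w)) (by
      rintro ⟨k, ω⟩ ⟨j, ω'⟩; simp only [Prod.mk.injEq, hZ]; grind),
    H_reweight hp (fun w => (B w, z w)) (by
      rintro ⟨k, ω⟩ ⟨j, ω'⟩; simp only [Prod.mk.injEq, hZ]; grind),
    H_reweight hp (fun w => (A w, B w, z w)) (by
      rintro ⟨k, ω⟩ ⟨j, ω'⟩; simp only [Prod.mk.injEq, hZ]; grind)]
  simp only [mul_sub, mul_add, Finset.sum_sub_distrib, Finset.sum_add_distrib]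
  ring

lemma cmi_congr {α' β' γ' : Type*} [Fintype α'] [Fintype β'] [Fintype γ'] [DecidableEq α']
    [DecidableEq β'] [DecidableEq γ'] [Fintype Ω] {μ : Ω → ℝ} {X : Ω → α} {Y : Ω → β} {Z : Ω → γ}
    {X' : Ω → α'} {Y' : Ω → β'} {Z' : Ω → γ'} (hX : Det μ X X') (hX' : Det μ X' X)
    (hY : Det μ Y Y') (hY' : Det μ Y' Y) (hZ : Det μ Z Z') (hZ' : Det μ Z' Z) :
    cmi μ X Y Z = cmi μ X' Y' Z' := by
  have e1 : H μ (fun ω => (X ω, Z ω)) = H μ (fun ω => (X' ω, Z' ω)) := by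
    refine H_congr ?_ ?_ <;>
    · intro ω ω' h h' e
      simp only [Prod.mk.injEq] at *; grind [Det]
  have e2 : H μ (fun ω => (Y ω, Z ω)) = H μ (fun ω => (Y' ω, Z' ω)) := by
    refine H_congr ?_ ?_ <;>
    · intro ω ω' h h' e
      simp only [Prod.mk.injEq] at *; grind [Det]
  have e3 : H μ (fun ω => (X ω, Y ω, Z ω)) = H μ (fun ω => (X' ω, Y' ω, Z' ω)) := by
    refine H_congr ?_ ?_ <;>
    · intro ω ω' h h' e
      simp only [Prod.mk.injEq] at *; grind [Det]
  simp only [cmi, e1, e2, e3, H_congr hZ hZ']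

end Reduction

section Cardinality

variable [Fintype 𝒳₁] [DecidableEq 𝒳₁] [Fintype 𝒳₂] [DecidableEq 𝒳₂]
  [Fintype 𝒴₁] [DecidableEq 𝒴₁] [Fintype 𝒴₂] [DecidableEq 𝒴₂]
  {q : 𝒳₁ × 𝒳₂ × 𝒴₁ × 𝒴₂ → ℝ} {𝒰 : Type} [Fintype 𝒰] [DecidableEq 𝒰]
  {p : 𝒰 × 𝒳₁ × 𝒳₂ × 𝒴₁ × 𝒴₂ → ℝ}

lemma rates_reweight (hp : ∀ a, 0 ≤ p a) {t : 𝒰 → ℝ}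
    (h : ∀ w, ∑ u, t u * p (u, w) = ∑ u, p (u, w)) (a b : ℝ) :
    a * rate₁ (reweight t p) + b * rate₂ (reweight t p) =
      a * (H p (fun a => (a.2.1, a.2.2.1)) - H p (fun a => a.2.2.1)) +
      b * (H p (fun a => (a.2.2.1, a.2.1)) - H p (fun a => a.2.1)) +
      ∑ u, t u * (a * (H (fun w => p (u, w)) (fun w => w.2.1) -
          H (fun w => p (u, w)) (fun w => (w.1, w.2.1))) +
        b * (H (fun w => p (u, w)) (fun w => w.1) -
          H (fun w => p (u, w)) (fun w => (w.2.1, w.1)))) := by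
  have hm : distr (reweight t p) Prod.snd = distr p Prod.snd := by
    funext w
    simp only [distr, Fintype.sum_prod_type, reweight, Finset.sum_ite_eq', Finset.mem_univ, if_true,
      h]
  have hH : ∀ {β : Type} [Fintype β] [DecidableEq β] (g : 𝒳₁ × 𝒳₂ × 𝒴₁ × 𝒴₂ → β),
      H (reweight t p) (fun a => g a.2) = H p (fun a => g a.2) := fun g => by
    rw [← H_distr _ Prod.snd g, ← H_distr p Prod.snd g, hm]
  have e1 := hH (fun w => (w.1, w.2.1))
  have e2 := hH (fun w => (w.2.1, w.1))
  have e3 := hH (fun w => w.1)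
  have e4 := hH (fun w => w.2.1)
  have r1 : rate₁ (reweight t p) = H p (fun a => (a.2.1, a.2.2.1)) - H p (fun a => a.2.2.1) +
      ∑ u, t u * (H (fun w => p (u, w)) (fun w => w.2.1) -
        H (fun w => p (u, w)) (fun w => (w.1, w.2.1))) := by
    simp only [rate₁, cmi]
    rw [e1, e4, H_reweight hp (fun w => w.2.1) (by simp),
      H_reweight hp (fun w => (w.1, w.2.1)) (by
        rintro ⟨u, w⟩ ⟨u', w'⟩; simp only [Prod.mk.injEq]; grind)]
    simp only [mul_sub, Finset.sum_sub_distrib]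
    ring
  have r2 : rate₂ (reweight t p) = H p (fun a => (a.2.2.1, a.2.1)) - H p (fun a => a.2.1) +
      ∑ u, t u * (H (fun w => p (u, w)) (fun w => w.1) -
        H (fun w => p (u, w)) (fun w => (w.2.1, w.1))) := by
    simp only [rate₂, cmi]
    rw [e2, e3, H_reweight hp (fun w => w.1) (by simp),
      H_reweight hp (fun w => (w.2.1, w.1)) (by
        rintro ⟨u, w⟩ ⟨u', w'⟩; simp only [Prod.mk.injEq]; grind)]
    simp only [mul_sub, Finset.sum_sub_distrib]
    ring
  rw [r1, r2, mul_add, mul_add, Finset.mul_sum, Finset.mul_sum]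
  simp only [mul_add, Finset.sum_add_distrib]
  have c1 : ∀ u (x : ℝ), a * (t u * x) = t u * (a * x) := fun u x => by ring
  have c2 : ∀ u (x : ℝ), b * (t u * x) = t u * (b * x) := fun u x => by ring
  simp only [c1, c2]
  ring

lemma Feasible.exists_reweight (hp : Feasible q p) (a b : ℝ) :
    ∃ t : 𝒰 → ℝ, Feasible q (reweight t p) ∧
      (∀ w, ∑ u, t u * p (u, w) = ∑ u, p (u, w)) ∧
      a * rate₁ (reweight t p) + b * rate₂ (reweight t p) ≤ a * rate₁ p + b * rate₂ p ∧
      (univ.filter (fun u => t u ≠ 0)).card ≤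
        Fintype.card 𝒳₁ * Fintype.card 𝒴₁ * Fintype.card 𝒳₂ * Fintype.card 𝒴₂ + 1 := by
  classical
  have hp0 := hp.pmf.1
  set I : 𝒰 → ℝ := fun u => cmi (fun w => p (u, w)) (fun w => w.1) (fun w => w.2.1) (fun _ => ())
    with hI
  have hIt : ∀ t : 𝒰 → ℝ, cmi (reweight t p) (fun a => a.2.1) (fun a => a.2.2.1) (fun a => a.1) =
      ∑ u, t u * I u := fun t =>
    cmi_reweight hp0 (fun w => w.1) (fun w => w.2.1) (fun _ => ()) (by simp)
  set K₁ : 𝒰 → ℝ := fun u => cmi (fun w => p (u, w)) (fun w => w.2.2.1)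
    (fun w => (w.2.1, w.2.2.2)) (fun w => w.1) with hK₁
  have hK₁t : ∀ t : 𝒰 → ℝ, cmi (reweight t p) (fun a => a.2.2.2.1)
      (fun a => (a.2.2.1, a.2.2.2.2)) (fun a => (a.1, a.2.1)) = ∑ u, t u * K₁ u := fun t =>
    cmi_reweight hp0 (fun w => w.2.2.1) (fun w => (w.2.1, w.2.2.2)) (fun w => w.1) (by simp)
  set K₂ : 𝒰 → ℝ := fun u => cmi (fun w => p (u, w)) (fun w => w.2.2.2)
    (fun w => (w.1, w.2.2.1)) (fun w => w.2.1) with hK₂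
  have hK₂t : ∀ t : 𝒰 → ℝ, cmi (reweight t p) (fun a => a.2.2.2.2)
      (fun a => (a.2.1, a.2.2.2.1)) (fun a => (a.1, a.2.2.1)) = ∑ u, t u * K₂ u := fun t =>
    cmi_reweight hp0 (fun w => w.2.2.2) (fun w => (w.1, w.2.2.1)) (fun w => w.2.1) (by simp)
  set c : 𝒰 → ℝ := fun u => a * (H (fun w => p (u, w)) (fun w => w.2.1) -
      H (fun w => p (u, w)) (fun w => (w.1, w.2.1))) +
    b * (H (fun w => p (u, w)) (fun w => w.1) - H (fun w => p (u, w)) (fun w => (w.2.1, w.1)))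
    with hc
  set t₀ : 𝒰 → ℝ := fun u => if ∃ w, p (u, w) ≠ 0 then 1 else 0 with ht₀
  have hmul : ∀ u w, t₀ u * p (u, w) = p (u, w) := fun u w => by
    by_cases h : ∃ w, p (u, w) ≠ 0
    · simp only [ht₀, if_pos h, one_mul]
    · push Not at h
      simp [h w]
  have hrw : reweight t₀ p = p := funext fun ⟨u, w⟩ => hmul u w
  have hz₁ := hp.markov₁
  have hz₂ := hp.markov₂
  have hi := hp.info
  rw [← hrw] at hz₁ hz₂ hi
  rw [hK₁t] at hz₁
  rw [hK₂t] at hz₂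
  rw [hIt] at hi
  have ht₀n : ∀ u, 0 ≤ t₀ u := fun u => by simp only [ht₀]; split_ifs <;> simp
  have hz₁ := (Finset.sum_eq_zero_iff_of_nonneg fun u _ =>
    mul_nonneg (ht₀n u) (cmi_nonneg (fun w => hp0 (u, w)) _ _ _)).1 hz₁
  have hz₂ := (Finset.sum_eq_zero_iff_of_nonneg fun u _ =>
    mul_nonneg (ht₀n u) (cmi_nonneg (fun w => hp0 (u, w)) _ _ _)).1 hz₂
  obtain ⟨t, ht, hts, hta, htc, htcard⟩ := exists_card_support_le
    (ι := Option (𝒳₁ × 𝒳₂ × 𝒴₁ × 𝒴₂)) (fun i u => i.elim (I u) fun w => p (u, w)) c t₀ ht₀n (by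
      intro v hv hvs hva
      funext u
      by_contra hne
      have hu : t₀ u ≠ 0 := fun h0 => hne (hvs u h0)
      obtain ⟨w, hw⟩ : ∃ w, p (u, w) ≠ 0 := by
        by_contra hcon
        exact hu (by simp only [ht₀, if_neg hcon])
      have := (Finset.sum_eq_zero_iff_of_nonneg fun u _ =>
        mul_nonneg (hv u) (hp0 (u, w))).1 (hva (some w)) u (Finset.mem_univ u)
      exact (mul_ne_zero hne hw) this)
  have hmarg : ∀ w, ∑ u, t u * p (u, w) = ∑ u, p (u, w) := fun w => by
    have := hta (some w)
    simpa only [Option.elim, hmul] using this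
  have hinfo : ∑ u, t u * I u = ∑ u, t₀ u * I u := hta none
  have hsupp : ∀ {K : 𝒰 → ℝ}, (∀ u ∈ univ, t₀ u * K u = 0) → ∑ u, t u * K u = 0 := fun hK =>
    Finset.sum_eq_zero fun u hu => by
      rcases mul_eq_zero.1 (hK u hu) with h | h
      · simp [hts u h]
      · simp [h]
  refine ⟨t, ⟨⟨fun x => mul_nonneg (ht _) (hp0 x), ?_⟩, ?_, ?_, ?_⟩, hmarg, ?_, ?_⟩
  · rw [← hp.pmf.2, Fintype.sum_prod_type_right p]
    exact (Fintype.sum_prod_type_right _).trans (Finset.sum_congr rfl fun w _ => hmarg w)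
  · rw [hIt, hinfo]; exact hi
  · rw [hK₁t]; exact hsupp hz₁
  · rw [hK₂t]; exact hsupp hz₂
  · have h1 := rates_reweight hp0 hmarg a b
    have h2 := rates_reweight hp0 (t := t₀) (fun w => by simp only [hmul]) a b
    rw [hrw] at h2
    rw [h1, h2]
    linarith
  · refine htcard.trans (le_of_eq ?_)
    simp only [Fintype.card_option, Fintype.card_prod]
    ring

lemma Feasible.mapIndex {𝒱 : Type} [Fintype 𝒱] [DecidableEq 𝒱] (hp : Feasible q p) (φ : 𝒰 → 𝒱)
    (hφ : ∀ a b, p a ≠ 0 → p b ≠ 0 → φ a.1 = φ b.1 → a.1 = b.1) :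
    ∃ p' : 𝒱 × 𝒳₁ × 𝒳₂ × 𝒴₁ × 𝒴₂ → ℝ, Feasible q p' ∧
      (∀ w, ∑ u, p' (u, w) = ∑ u, p (u, w)) ∧ rate₁ p' = rate₁ p ∧ rate₂ p' = rate₂ p := by
  set p' := distr p (fun a => (φ a.1, a.2)) with hp'
  have hcmi : ∀ {α β γ α' β' γ' : Type} [Fintype α] [Fintype β] [Fintype γ] [DecidableEq α]
      [DecidableEq β] [DecidableEq γ] [Fintype α'] [Fintype β'] [Fintype γ'] [DecidableEq α']
      [DecidableEq β'] [DecidableEq γ'] (A : 𝒱 × 𝒳₁ × 𝒳₂ × 𝒴₁ × 𝒴₂ → α)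
      (B : 𝒱 × 𝒳₁ × 𝒳₂ × 𝒴₁ × 𝒴₂ → β) (Z : 𝒱 × 𝒳₁ × 𝒳₂ × 𝒴₁ × 𝒴₂ → γ)
      (A' : 𝒰 × 𝒳₁ × 𝒳₂ × 𝒴₁ × 𝒴₂ → α')
      (B' : 𝒰 × 𝒳₁ × 𝒳₂ × 𝒴₁ × 𝒴₂ → β') (Z' : 𝒰 × 𝒳₁ × 𝒳₂ × 𝒴₁ × 𝒴₂ → γ')
      (_ : ∀ a b, (φ a.1 = φ b.1 ↔ a.1 = b.1) →
        (A (φ a.1, a.2) = A (φ b.1, b.2) ↔ A' a = A' b) ∧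
        (B (φ a.1, a.2) = B (φ b.1, b.2) ↔ B' a = B' b) ∧
        (Z (φ a.1, a.2) = Z (φ b.1, b.2) ↔ Z' a = Z' b)),
      cmi p' A B Z = cmi p A' B' Z' := by
    intro α β γ α' β' γ' _ _ _ _ _ _ _ _ _ _ _ _ A B Z A' B' Z' h
    have hφ' : ∀ a b, p a ≠ 0 → p b ≠ 0 → (φ a.1 = φ b.1 ↔ a.1 = b.1) := fun a b ha hb =>
      ⟨hφ a b ha hb, congrArg φ⟩
    have : cmi p' A B Z = cmi p (fun a => A (φ a.1, a.2)) (fun a => B (φ a.1, a.2))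
        (fun a => Z (φ a.1, a.2)) := by
      simp only [cmi, hp', H_distr]
    rw [this]
    exact cmi_congr (fun a b ha hb e => (h a b (hφ' a b ha hb)).1.1 e)
      (fun a b ha hb e => (h a b (hφ' a b ha hb)).1.2 e)
      (fun a b ha hb e => (h a b (hφ' a b ha hb)).2.1.1 e)
      (fun a b ha hb e => (h a b (hφ' a b ha hb)).2.1.2 e)
      (fun a b ha hb e => (h a b (hφ' a b ha hb)).2.2.1 e)
      (fun a b ha hb e => (h a b (hφ' a b ha hb)).2.2.2 e)
  refine ⟨p', ⟨isPMF_distr hp.pmf _, ?_, ?_, ?_⟩, fun w => ?_, ?_, ?_⟩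
  · exact (hcmi _ _ _ _ _ _ (fun a b h => by simp [h])).trans_le hp.info
  · exact (hcmi _ _ _ _ _ _ (fun a b h => by simp [h])).trans hp.markov₁
  · exact (hcmi _ _ _ _ _ _ (fun a b h => by simp [h])).trans hp.markov₂
  · rw [hp', distr_pair_sum p (fun a => φ a.1) Prod.snd w]
    simp [distr, Fintype.sum_prod_type]
  · exact hcmi _ _ _ _ _ _ (fun a b h => by simp [h])
  · exact hcmi _ _ _ _ _ _ (fun a b h => by simp [h])

lemma Feasible.exists_fin (hp : Feasible q p) (a b : ℝ) :
    ∃ p' : Fin (Fintype.card 𝒳₁ * Fintype.card 𝒴₁ * Fintype.card 𝒳₂ * Fintype.card 𝒴₂ + 1) ×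
        𝒳₁ × 𝒳₂ × 𝒴₁ × 𝒴₂ → ℝ,
      Feasible q p' ∧ (∀ w, ∑ u, p' (u, w) = ∑ u, p (u, w)) ∧
      a * rate₁ p' + b * rate₂ p' ≤ a * rate₁ p + b * rate₂ p := by
  obtain ⟨t, ht, hm, hr, hcard⟩ := hp.exists_reweight a b
  set N := Fintype.card 𝒳₁ * Fintype.card 𝒴₁ * Fintype.card 𝒳₂ * Fintype.card 𝒴₂ + 1
  obtain ⟨e⟩ : Nonempty ({u // t u ≠ 0} ↪ Fin N) :=
    Function.Embedding.nonempty_of_card_le (by rwa [Fintype.card_subtype, Fintype.card_fin])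
  obtain ⟨p', h1, h2, h3, h4⟩ := ht.mapIndex
    (fun u => if hu : t u ≠ 0 then e ⟨u, hu⟩ else ⟨0, Nat.succ_pos _⟩) (by
      intro x y hx hy hxy
      have hx' := left_ne_zero_of_mul hx
      have hy' := left_ne_zero_of_mul hy
      simp only [dif_pos hx', dif_pos hy'] at hxy
      exact congrArg Subtype.val (e.injective hxy))
  exact ⟨p', h1, fun w => (h2 w).trans (hm w), by rw [h3, h4]; exact hr⟩

end Cardinality

section Limit

lemma continuous_H [Fintype Ω] [Fintype α] [DecidableEq α] (X : Ω → α) :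
    Continuous fun μ : Ω → ℝ => H μ X := by
  have hd : ∀ a, Continuous fun μ : Ω → ℝ => distr μ X a := fun a => by
    refine continuous_finsetSum _ fun ω _ => ?_
    split_ifs
    · exact continuous_apply ω
    · exact continuous_const
  refine (continuous_finsetSum _ fun a _ => ?_).neg
  simp only [Real.logb, mul_div_assoc']
  exact (Real.continuous_mul_log.comp (hd a)).div_const _

lemma continuous_cmi [Fintype Ω] [Fintype α] [DecidableEq α] [Fintype β] [DecidableEq β]
    [Fintype γ] [DecidableEq γ] (X : Ω → α) (Y : Ω → β) (Z : Ω → γ) :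
    Continuous fun μ : Ω → ℝ => cmi μ X Y Z :=
  (((continuous_H _).add (continuous_H _)).sub (continuous_H _)).sub (continuous_H _)

variable [Fintype 𝒳₁] [DecidableEq 𝒳₁] [Fintype 𝒳₂] [DecidableEq 𝒳₂]
  [Fintype 𝒴₁] [DecidableEq 𝒴₁] [Fintype 𝒴₂] [DecidableEq 𝒴₂]
  {q : 𝒳₁ × 𝒳₂ × 𝒴₁ × 𝒴₂ → ℝ} {r : ℕ} {R12 R21 : ℝ}

lemma Admissible.exists_limit (hq : IsPMF q) (h : Admissible q r R12 R21) (a b : ℝ) :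
    ∃ (p : Fin (Fintype.card 𝒳₁ * Fintype.card 𝒴₁ * Fintype.card 𝒳₂ * Fintype.card 𝒴₂ + 1) ×
        𝒳₁ × 𝒳₂ × 𝒴₁ × 𝒴₂ → ℝ) (d₁ d₂ : ℝ),
      Feasible q p ∧ (∀ w, ∑ u, p (u, w) = q w) ∧ 0 ≤ d₁ ∧ 0 ≤ d₂ ∧ outputCorr q ≤ d₁ + d₂ ∧
      a * (rate₁ p + d₁) + b * (rate₂ p + d₂) ≤ a * R12 + b * R21 := by
  obtain ⟨κ, hκ⟩ := h.exists_feasible hq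
  set N := Fintype.card 𝒳₁ * Fintype.card 𝒴₁ * Fintype.card 𝒳₂ * Fintype.card 𝒴₂ + 1
  set ε : ℕ → ℝ := fun m => 1 / ((m : ℝ) + 1) with hε
  have hfin : ∀ m, ∃ x : (Fin N × 𝒳₁ × 𝒳₂ × 𝒴₁ × 𝒴₂ → ℝ) × ℝ × ℝ, Feasible q x.1 ∧
      (∀ w, |∑ u, x.1 (u, w) - q w| ≤ ε m) ∧ (0 ≤ x.2.1 ∧ x.2.1 ≤ R12) ∧
      (0 ≤ x.2.2 ∧ x.2.2 ≤ R21) ∧ outputCorr q ≤ x.2.1 + x.2.2 + κ * ε m ∧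
      a * (rate₁ x.1 + x.2.1) + b * (rate₂ x.1 + x.2.2) ≤ a * R12 + b * R21 := fun m => by
    obtain ⟨𝒰, _, _, p, hp, hpq, h₁, h₂, h₃⟩ := hκ (ε m) Nat.one_div_pos_of_nat
      ((div_le_one (by positivity)).2 (by linarith [(Nat.cast_nonneg m : (0 : ℝ) ≤ m)]))
    obtain ⟨p', hp', hm, hr⟩ := hp.exists_fin a b
    have n₁ : 0 ≤ rate₁ p := cmi_nonneg hp.pmf.1 _ _ _
    have n₂ : 0 ≤ rate₂ p := cmi_nonneg hp.pmf.1 _ _ _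
    refine ⟨(p', R12 - rate₁ p, R21 - rate₂ p), hp', fun w => by rw [hm w]; exact hpq w,
      ⟨by linarith, by linarith⟩, ⟨by linarith, by linarith⟩, by linarith, ?_⟩
    linarith
  choose x hx using hfin
  have hcompact : IsCompact
      ((Set.univ.pi fun _ : Fin N × 𝒳₁ × 𝒳₂ × 𝒴₁ × 𝒴₂ => Set.Icc (0 : ℝ) 1) ×ˢ
        (Set.Icc 0 R12 ×ˢ Set.Icc 0 R21)) :=
    (isCompact_univ_pi fun _ => isCompact_Icc).prod (isCompact_Icc.prod isCompact_Icc)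
  obtain ⟨l, -, φ, hφ, hl⟩ := hcompact.tendsto_subseq (x := x) fun m =>
    ⟨fun i _ => ⟨(hx m).1.pmf.1 i, (hx m).1.pmf.2 ▸
      Finset.single_le_sum (fun j _ => (hx m).1.pmf.1 j) (Finset.mem_univ i)⟩,
      (hx m).2.2.1, (hx m).2.2.2.1⟩
  have hε0 : Filter.Tendsto (fun m => ε (φ m)) Filter.atTop (nhds 0) :=
    tendsto_one_div_add_atTop_nhds_zero_nat.comp hφ.tendsto_atTop
  have hlim : ∀ (g : (Fin N × 𝒳₁ × 𝒳₂ × 𝒴₁ × 𝒴₂ → ℝ) × ℝ × ℝ → ℝ) (s : ℝ), Continuous g →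
      (∀ m, g (x m) ≤ s * ε m) → g l ≤ 0 := fun g s hg hle => by
    have h1 := (hg.tendsto l).comp hl
    have h2 := hε0.const_mul s
    rw [mul_zero] at h2
    exact le_of_tendsto_of_tendsto' h1 h2 fun m => hle (φ m)
  have hlim0 : ∀ (g : (Fin N × 𝒳₁ × 𝒳₂ × 𝒴₁ × 𝒴₂ → ℝ) × ℝ × ℝ → ℝ), Continuous g →
      (∀ m, g (x m) = 0) → g l = 0 := fun g hg he =>
    le_antisymm (hlim g 0 hg fun m => by simp [he m])
      (neg_nonpos.1 (hlim (fun y => - g y) 0 hg.neg fun m => by simp [he m]))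
  have happ : ∀ i, Continuous fun y : (Fin N × 𝒳₁ × 𝒳₂ × 𝒴₁ × 𝒴₂ → ℝ) × ℝ × ℝ => y.1 i :=
    fun i => (continuous_apply i).comp continuous_fst
  have c₁ : Continuous fun y : (Fin N × 𝒳₁ × 𝒳₂ × 𝒴₁ × 𝒴₂ → ℝ) × ℝ × ℝ => y.2.1 :=
    continuous_fst.comp continuous_snd
  have c₂ : Continuous fun y : (Fin N × 𝒳₁ × 𝒳₂ × 𝒴₁ × 𝒴₂ → ℝ) × ℝ × ℝ => y.2.2 :=
    continuous_snd.comp continuous_snd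
  have hr₁ : Continuous fun y : (Fin N × 𝒳₁ × 𝒳₂ × 𝒴₁ × 𝒴₂ → ℝ) × ℝ × ℝ => rate₁ y.1 :=
    (continuous_cmi _ _ _).comp continuous_fst
  have hr₂ : Continuous fun y : (Fin N × 𝒳₁ × 𝒳₂ × 𝒴₁ × 𝒴₂ → ℝ) × ℝ × ℝ => rate₂ y.1 :=
    (continuous_cmi _ _ _).comp continuous_fst
  refine ⟨l.1, l.2.1, l.2.2, ⟨⟨fun i => ?_, ?_⟩, ?_, ?_, ?_⟩, fun w => ?_, ?_, ?_, ?_, ?_⟩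
  · exact neg_nonpos.1 (hlim (fun y => - y.1 i) 0 (happ i).neg fun m => by
      simpa using (hx m).1.pmf.1 i)
  · exact sub_eq_zero.1 (hlim0 (fun y => ∑ i, y.1 i - 1)
      ((continuous_finsetSum _ fun i _ => happ i).sub continuous_const) fun m => by
        rw [(hx m).1.pmf.2, sub_self])
  · exact sub_nonpos.1 (hlim (fun y => cmi y.1 _ _ _ - _) 0
      (((continuous_cmi _ _ _).comp continuous_fst).sub continuous_const) fun m => by
        rw [zero_mul]
        exact sub_nonpos.2 (hx m).1.info)
  · exact hlim0 (fun y => cmi y.1 _ _ _) ((continuous_cmi _ _ _).comp continuous_fst)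
      fun m => (hx m).1.markov₁
  · exact hlim0 (fun y => cmi y.1 _ _ _) ((continuous_cmi _ _ _).comp continuous_fst)
      fun m => (hx m).1.markov₂
  · exact sub_eq_zero.1 (abs_nonpos_iff.1 (hlim (fun y => |∑ u, y.1 (u, w) - q w|) 1
      ((continuous_finsetSum _ fun u _ => happ (u, w)).sub continuous_const).abs fun m => by
        rw [one_mul]
        exact (hx m).2.1 w))
  · exact neg_nonpos.1 (hlim (fun y => - y.2.1) 0 c₁.neg fun m => by
      simpa using (hx m).2.2.1.1)
  · exact neg_nonpos.1 (hlim (fun y => - y.2.2) 0 c₂.neg fun m => by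
      simpa using (hx m).2.2.2.1.1)
  · exact sub_nonpos.1 (hlim (fun y => outputCorr q - (y.2.1 + y.2.2)) κ
      (continuous_const.sub (c₁.add c₂)) fun m => by linarith [(hx m).2.2.2.2.1])
  · exact sub_nonpos.1 (hlim (fun y => a * (rate₁ y.1 + y.2.1) + b * (rate₂ y.1 + y.2.2) -
      (a * R12 + b * R21)) 0 (((continuous_const.mul (hr₁.add c₁)).add
        (continuous_const.mul (hr₂.add c₂))).sub continuous_const) fun m => by
          linarith [(hx m).2.2.2.2.2])

end Limit

/-- Theorem 3 of the paper, converse with no constraint on the number of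
rounds. For every `r ≥ 1`, if `(R12, R21)` is admissible for `q` with `r` interactive
rounds, then `(R12, R21)` lies in the closed convex hull of the pairs `(R'₁₂, R'₂₁)` for
which there is a finite auxiliary alphabet `𝒰` with `|𝒰| ≤ |𝒳¹||𝒴¹||𝒳²||𝒴²| + 1` and a
pmf `p(u,x¹,x²,y¹,y²)` with `(x¹,x²,y¹,y²)`-marginal `q`, satisfying
`I_p(X¹;X²|U) ≤ I_q(X¹;X²)` and the Markov chains `Y¹ – (U,X¹) – (X²,Y²)` and
`Y² – (U,X²) – (X¹,Y¹)`, such that `R'₁₂ ≥ I_p(X¹;U|X²)`, `R'₂₁ ≥ I_p(X²;U|X¹)` and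
`R'₁₂ + R'₂₁ ≥ I_p(X¹;U|X²) + I_p(X²;U|X¹) + I_q(Y¹;Y²|X¹,X²)`.
Coordinates on `𝒰 × 𝒳₁ × 𝒳₂ × 𝒴₁ × 𝒴₂`: `a.1 = u`, `a.2.1 = x¹`, `a.2.2.1 = x²`,
`a.2.2.2.1 = y¹`, `a.2.2.2.2 = y²`. -/
theorem round_free_converse
    [Fintype 𝒳₁] [DecidableEq 𝒳₁] [Fintype 𝒳₂] [DecidableEq 𝒳₂]
    [Fintype 𝒴₁] [DecidableEq 𝒴₁] [Fintype 𝒴₂] [DecidableEq 𝒴₂]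
    (q : 𝒳₁ × 𝒳₂ × 𝒴₁ × 𝒴₂ → ℝ) (hq : IsPMF q)
    (r : ℕ) (hr : 1 ≤ r) (R12 R21 : ℝ)
    (hadm : Admissible q r R12 R21) :
    (R12, R21) ∈ closure (convexHull ℝ
      {R : ℝ × ℝ | ∃ (𝒰 : Type) (_ : Fintype 𝒰) (_ : DecidableEq 𝒰)
        (p : 𝒰 × 𝒳₁ × 𝒳₂ × 𝒴₁ × 𝒴₂ → ℝ),
        IsPMF p ∧
        -- the (x¹,x²,y¹,y²)-marginal of p is q
        (∀ x₁ x₂ y₁ y₂, (∑ u, p (u, x₁, x₂, y₁, y₂)) = q (x₁, x₂, y₁, y₂)) ∧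
        -- I_p(X¹; X² | U) ≤ I_q(X¹; X²)
        cmi p (fun a => a.2.1) (fun a => a.2.2.1) (fun a => a.1) ≤
          mi q (fun a => a.1) (fun a => a.2.1) ∧
        -- Y¹ – (U, X¹) – (X², Y²)
        cmi p (fun a => a.2.2.2.1) (fun a => (a.2.2.1, a.2.2.2.2))
          (fun a => (a.1, a.2.1)) = 0 ∧
        -- Y² – (U, X²) – (X¹, Y¹)
        cmi p (fun a => a.2.2.2.2) (fun a => (a.2.1, a.2.2.2.1))
          (fun a => (a.1, a.2.2.1)) = 0 ∧
        -- cardinality bound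
        Fintype.card 𝒰 ≤
          Fintype.card 𝒳₁ * Fintype.card 𝒴₁ * Fintype.card 𝒳₂ * Fintype.card 𝒴₂ + 1 ∧
        -- rate constraints
        R.1 ≥ cmi p (fun a => a.2.1) (fun a => a.1) (fun a => a.2.2.1) ∧
        R.2 ≥ cmi p (fun a => a.2.2.1) (fun a => a.1) (fun a => a.2.1) ∧
        R.1 + R.2 ≥ cmi p (fun a => a.2.1) (fun a => a.1) (fun a => a.2.2.1)
          + cmi p (fun a => a.2.2.1) (fun a => a.1) (fun a => a.2.1)
          + cmi q (fun a => a.2.2.1) (fun a => a.2.2.2) (fun a => (a.1, a.2.1))}) := by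
  set N := Fintype.card 𝒳₁ * Fintype.card 𝒴₁ * Fintype.card 𝒳₂ * Fintype.card 𝒴₂ + 1 with hN
  by_contra hR
  obtain ⟨ℓ, c, hℓR, hℓ⟩ :=
    geometric_hahn_banach_point_closed (convex_convexHull ℝ _).closure isClosed_closure hR
  have hℓe : ∀ x y : ℝ, ℓ (x, y) = ℓ (1, 0) * x + ℓ (0, 1) * y := fun x y => by
    have : ((x, y) : ℝ × ℝ) = x • (1, 0) + y • (0, 1) := by simp
    rw [this, map_add, map_smul, map_smul, smul_eq_mul, smul_eq_mul, mul_comm x, mul_comm y]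
  obtain ⟨p, d₁, d₂, hp, hpq, h₁, h₂, h₃, h₄⟩ :=
    hadm.exists_limit hq (ℓ (1, 0)) (ℓ (0, 1))
  have hmem := hℓ (rate₁ p + d₁, rate₂ p + d₂) (subset_closure (subset_convexHull ℝ _
    ⟨Fin N, inferInstance, inferInstance, p, hp.pmf, fun x₁ x₂ y₁ y₂ => hpq _, hp.info, hp.markov₁,
      hp.markov₂, by simp [hN], ?_, ?_, ?_⟩))
  · rw [hℓe] at hmem hℓR
    linarith
  · change rate₁ p ≤ rate₁ p + d₁
    linarith
  · change rate₂ p ≤ rate₂ p + d₂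
    linarith
  · change rate₁ p + rate₂ p + outputCorr q ≤ rate₁ p + d₁ + (rate₂ p + d₂)
    linarith

end Coord
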